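/- arXiv:2110.13147 — 4 statements merged into one kernel-verified Lean document; each statement's English description precedes it below -/
import Mathlib

section
/- Let α ∈ (0,1] and λ > 0. Then, as t → ∞, E_α(λ t^α) = (1/α)·exp(λ^{1/α} t) + O(t^{-α}); that is, the function t ↦ E_α(λ t^α) − (1/α)·exp(λ^{1/α} t) is O(t^{-α}) as t → ∞. In particular, E_α(λ t^α) grows exponentially towards ∞ as t → ∞. -/
/-- The one-parameter Mittag-Leffler function `E_α(x) = ∑_{k=0}^∞ x^k / Γ(αk+1)`. -/
noncomputable def mittagLeffler (α x : ℝ) : ℝ :=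
  ∑' k : ℕ, x ^ k / Real.Gamma (α * (k : ℝ) + 1)

open Complex MeasureTheory Set Filter Topology

/-- The U-shaped path in the strip `|Im w| ≤ π` with left end on `Re w = a`. Its image under `exp`
is a Hankel contour. -/
def hankelContour (a : ℝ) : Set ℂ :=
  {w | a ≤ w.re ∧ |w.im| ≤ Real.pi ∧ (w.re = a ∨ |w.im| = Real.pi)}

/-- The integral of `F` along `hankelContour a`, run through with increasing imaginary part. -/
noncomputable def hankelIntegral (a : ℝ) (F : ℂ → ℂ) : ℂ :=
  I * (∫ θ in (-Real.pi)..Real.pi, F (a + θ * I)) +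
    ((∫ x in Ioi a, F (x + (Real.pi : ℝ) * I)) - ∫ x in Ioi a, F (x + (-Real.pi : ℝ) * I))

/-- Integrability along the three sides of `hankelContour a`. -/
def HankelIntegrable (a : ℝ) (F : ℂ → ℂ) : Prop :=
  IntervalIntegrable (fun θ : ℝ => F (a + θ * I)) volume (-Real.pi) Real.pi ∧
    IntegrableOn (fun x : ℝ => F (x + (Real.pi : ℝ) * I)) (Ioi a) ∧
    IntegrableOn (fun x : ℝ => F (x + (-Real.pi : ℝ) * I)) (Ioi a)

lemma left_mem_hankelContour (a : ℝ) {θ : ℝ} (hθ : |θ| ≤ Real.pi) :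
    (a + θ * I : ℂ) ∈ hankelContour a := by
  simp [hankelContour, hθ]

lemma top_mem_hankelContour {a x : ℝ} (hx : a ≤ x) :
    (x + (Real.pi : ℝ) * I : ℂ) ∈ hankelContour a := by
  simp [hankelContour, hx, abs_of_pos Real.pi_pos]

lemma bottom_mem_hankelContour {a x : ℝ} (hx : a ≤ x) :
    (x + (-Real.pi : ℝ) * I : ℂ) ∈ hankelContour a := by
  simp [hankelContour, hx, abs_of_pos Real.pi_pos]

lemma hankelIntegral_congr {a : ℝ} {F G : ℂ → ℂ} (h : EqOn F G (hankelContour a)) :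
    hankelIntegral a F = hankelIntegral a G := by
  have h1 : ∫ θ in (-Real.pi)..Real.pi, F (a + θ * I)
      = ∫ θ in (-Real.pi)..Real.pi, G (a + θ * I) := by
    refine intervalIntegral.integral_congr fun θ hθ => h (left_mem_hankelContour a ?_)
    rwa [uIcc_of_le (by linarith [Real.pi_pos]), mem_Icc, ← abs_le] at hθ
  have h2 : ∫ x in Ioi a, F (x + (Real.pi : ℝ) * I) = ∫ x in Ioi a, G (x + (Real.pi : ℝ) * I) :=
    setIntegral_congr_fun measurableSet_Ioi fun x hx => h (top_mem_hankelContour (le_of_lt hx))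
  have h3 : ∫ x in Ioi a, F (x + (-Real.pi : ℝ) * I)
      = ∫ x in Ioi a, G (x + (-Real.pi : ℝ) * I) :=
    setIntegral_congr_fun measurableSet_Ioi fun x hx => h (bottom_mem_hankelContour (le_of_lt hx))
  rw [hankelIntegral, hankelIntegral, h1, h2, h3]

lemma HankelIntegrable.add {a : ℝ} {F G : ℂ → ℂ} (hF : HankelIntegrable a F)
    (hG : HankelIntegrable a G) : HankelIntegrable a (fun w => F w + G w) :=
  ⟨hF.1.add hG.1, hF.2.1.add hG.2.1, hF.2.2.add hG.2.2⟩

lemma HankelIntegrable.const_mul {a : ℝ} {F : ℂ → ℂ} (c : ℂ) (hF : HankelIntegrable a F) :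
    HankelIntegrable a (fun w => c * F w) :=
  ⟨hF.1.const_mul c, Integrable.const_mul hF.2.1 c, Integrable.const_mul hF.2.2 c⟩

lemma HankelIntegrable.congr {a : ℝ} {F G : ℂ → ℂ} (hF : HankelIntegrable a F)
    (h : EqOn F G (hankelContour a)) : HankelIntegrable a G := by
  refine ⟨hF.1.congr fun θ hθ => h (left_mem_hankelContour a ?_),
    hF.2.1.congr_fun (fun x hx => h (top_mem_hankelContour (le_of_lt hx))) measurableSet_Ioi,
    hF.2.2.congr_fun (fun x hx => h (bottom_mem_hankelContour (le_of_lt hx))) measurableSet_Ioi⟩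
  rw [uIoc_of_le (by linarith [Real.pi_pos])] at hθ
  exact abs_le.2 ⟨hθ.1.le, hθ.2⟩

lemma hankelIntegral_add {a : ℝ} {F G : ℂ → ℂ} (hF : HankelIntegrable a F)
    (hG : HankelIntegrable a G) :
    hankelIntegral a (fun w => F w + G w) = hankelIntegral a F + hankelIntegral a G := by
  rw [hankelIntegral, intervalIntegral.integral_add hF.1 hG.1, integral_add hF.2.1 hG.2.1,
    integral_add hF.2.2 hG.2.2, hankelIntegral, hankelIntegral]
  ring

lemma hankelIntegral_const_mul {a : ℝ} (c : ℂ) (F : ℂ → ℂ) :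
    hankelIntegral a (fun w => c * F w) = c * hankelIntegral a F := by
  simp only [hankelIntegral, intervalIntegral.integral_const_mul, integral_const_mul]
  ring

lemma exp_exp_add_pi (x : ℝ) : exp (exp (x + (Real.pi : ℝ) * I)) = (Real.exp (-Real.exp x) : ℝ) := by
  rw [Complex.exp_add, Complex.exp_pi_mul_I]; simp

lemma exp_exp_sub_pi (x : ℝ) :
    exp (exp (x + (-Real.pi : ℝ) * I)) = (Real.exp (-Real.exp x) : ℝ) := by
  rw [Complex.exp_add, Complex.ofReal_neg, neg_mul, Complex.exp_neg (_ * I), Complex.exp_pi_mul_I]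
  simp

lemma norm_exp_exp_le (w : ℂ) : ‖exp (exp w)‖ ≤ Real.exp (Real.exp w.re) := by
  rw [Complex.norm_exp, ← Complex.norm_exp w]
  exact Real.exp_le_exp.2 (Complex.re_le_norm _)

lemma tendsto_exp_neg_exp_mul_exp (c : ℝ) :
    Tendsto (fun x : ℝ => Real.exp (-Real.exp x) * Real.exp (c * x)) atTop (𝓝 0) := by
  refine ((tendsto_rpow_mul_exp_neg_mul_atTop_nhds_zero c 1 one_pos).comp
    Real.tendsto_exp_atTop).congr fun x => ?_
  simp [← Real.exp_mul, mul_comm]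

lemma integrableOn_exp_neg_exp_mul_exp (a c : ℝ) :
    IntegrableOn (fun x : ℝ => Real.exp (-Real.exp x) * Real.exp (c * x)) (Ioi a) := by
  refine integrable_of_isBigO_exp_neg one_pos (by fun_prop) ?_
  refine (Asymptotics.isLittleO_of_tendsto (by simp) ?_).isBigO
  refine (tendsto_exp_neg_exp_mul_exp (c + 1)).congr fun x => ?_
  rw [mul_div_assoc, ← Real.exp_sub]; ring_nf

section Bound

variable {a C c : ℝ} {F : ℂ → ℂ}

lemma hankelIntegrable_of_le (hF : ∀ w ∈ hankelContour a, ContinuousAt F w)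
    (hb : ∀ w ∈ hankelContour a, ‖F w‖ ≤ C * (‖exp (exp w)‖ * Real.exp (c * w.re))) :
    HankelIntegrable a F := by
  refine ⟨ContinuousOn.intervalIntegrable fun θ hθ => ?_, ?_, ?_⟩
  · rw [uIcc_of_le (by linarith [Real.pi_pos]), mem_Icc, ← abs_le] at hθ
    exact (ContinuousAt.comp (f := fun θ : ℝ => (a + θ * I : ℂ)) (hF _ (left_mem_hankelContour a hθ))
      (by fun_prop)).continuousWithinAt
  · refine Integrable.mono' ((integrableOn_exp_neg_exp_mul_exp a c).const_mul C)
      (ContinuousOn.aestronglyMeasurable (fun x hx => ?_) measurableSet_Ioi)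
      (ae_restrict_of_forall_mem measurableSet_Ioi fun x hx => ?_)
    · exact (ContinuousAt.comp (f := fun x : ℝ => (x + (Real.pi : ℝ) * I : ℂ))
        (hF _ (top_mem_hankelContour (le_of_lt hx))) (by fun_prop)).continuousWithinAt
    · refine (hb _ (top_mem_hankelContour (le_of_lt hx))).trans_eq ?_
      rw [exp_exp_add_pi, Complex.norm_real, Real.norm_of_nonneg (Real.exp_nonneg _)]; simp
  · refine Integrable.mono' ((integrableOn_exp_neg_exp_mul_exp a c).const_mul C)
      (ContinuousOn.aestronglyMeasurable (fun x hx => ?_) measurableSet_Ioi)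
      (ae_restrict_of_forall_mem measurableSet_Ioi fun x hx => ?_)
    · exact (ContinuousAt.comp (f := fun x : ℝ => (x + (-Real.pi : ℝ) * I : ℂ))
        (hF _ (bottom_mem_hankelContour (le_of_lt hx))) (by fun_prop)).continuousWithinAt
    · refine (hb _ (bottom_mem_hankelContour (le_of_lt hx))).trans_eq ?_
      rw [exp_exp_sub_pi, Complex.norm_real, Real.norm_of_nonneg (Real.exp_nonneg _)]; simp

/-- The constant in the estimate of a Hankel integral with integrand of growth `exp (c * Re w)`
relative to `exp (exp w)`. -/
noncomputable def hankelBound (a c : ℝ) : ℝ :=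
  Real.exp (Real.exp a) * Real.exp (c * a) * (2 * Real.pi) +
    2 * ∫ x in Ioi a, Real.exp (-Real.exp x) * Real.exp (c * x)

lemma norm_hankelIntegral_le (hC : 0 ≤ C)
    (hb : ∀ w ∈ hankelContour a, ‖F w‖ ≤ C * (‖exp (exp w)‖ * Real.exp (c * w.re))) :
    ‖hankelIntegral a F‖ ≤ C * hankelBound a c := by
  have h1 : ‖∫ θ in (-Real.pi)..Real.pi, F (a + θ * I)‖
      ≤ C * (Real.exp (Real.exp a) * Real.exp (c * a)) * |Real.pi - -Real.pi| := by
    refine intervalIntegral.norm_integral_le_of_norm_le_const fun θ hθ => ?_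
    rw [uIoc_of_le (by linarith [Real.pi_pos])] at hθ
    refine (hb _ (left_mem_hankelContour a (abs_le.2 ⟨hθ.1.le, hθ.2⟩))).trans ?_
    have := norm_exp_exp_le (a + θ * I)
    simp only [add_re, ofReal_re, mul_re, I_re, mul_zero, ofReal_im, I_im, mul_one, sub_self,
      add_zero] at this ⊢
    gcongr
  have hi := (integrableOn_exp_neg_exp_mul_exp a c).const_mul C
  have h2 : ‖∫ x in Ioi a, F (x + (Real.pi : ℝ) * I)‖
      ≤ ∫ x in Ioi a, C * (Real.exp (-Real.exp x) * Real.exp (c * x)) := by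
    refine norm_integral_le_of_norm_le hi
      (ae_restrict_of_forall_mem measurableSet_Ioi fun x hx => ?_)
    refine (hb _ (top_mem_hankelContour (le_of_lt hx))).trans_eq ?_
    rw [exp_exp_add_pi, Complex.norm_real, Real.norm_of_nonneg (Real.exp_nonneg _)]; simp
  have h3 : ‖∫ x in Ioi a, F (x + (-Real.pi : ℝ) * I)‖
      ≤ ∫ x in Ioi a, C * (Real.exp (-Real.exp x) * Real.exp (c * x)) := by
    refine norm_integral_le_of_norm_le hi
      (ae_restrict_of_forall_mem measurableSet_Ioi fun x hx => ?_)
    refine (hb _ (bottom_mem_hankelContour (le_of_lt hx))).trans_eq ?_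
    rw [exp_exp_sub_pi, Complex.norm_real, Real.norm_of_nonneg (Real.exp_nonneg _)]; simp
  rw [integral_const_mul] at h2 h3
  rw [abs_of_pos (by linarith [Real.pi_pos])] at h1
  refine (norm_add_le _ _).trans ((add_le_add_right (norm_sub_le _ _) _).trans ?_)
  rw [norm_mul, Complex.norm_I, one_mul, hankelBound]
  linarith

end Bound

/-- By the Cauchy theorem, the left side of the contour can be moved. -/
lemma hankelIntegral_shift {a b : ℝ} (hab : a ≤ b) {F : ℂ → ℂ}
    (hF : ∀ w : ℂ, a ≤ w.re → |w.im| ≤ Real.pi → DifferentiableAt ℂ F w)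
    (hi : HankelIntegrable a F) : hankelIntegral a F = hankelIntegral b F := by
  have key := Complex.integral_boundary_rect_eq_zero_of_differentiableOn F ⟨a, -Real.pi⟩
    ⟨b, Real.pi⟩ (fun w hw => by
      rw [mem_reProdIm, uIcc_of_le hab, uIcc_of_le (by linarith [Real.pi_pos])] at hw
      exact (hF w hw.1.1 (abs_le.2 hw.2)).differentiableWithinAt)
  have split (y : ℝ) (h : IntegrableOn (fun x : ℝ => F (x + y * I)) (Ioi a)) :
      ∫ x in Ioi a, F (x + y * I) = (∫ x in a..b, F (x + y * I)) + ∫ x in Ioi b, F (x + y * I) := by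
    rw [← intervalIntegral.integral_Ioi_sub_Ioi h hab, sub_add_cancel]
  simp only [hankelIntegral]
  rw [split _ hi.2.1, split _ hi.2.2]
  simp only [smul_eq_mul] at key
  linear_combination -key

/-- The integral of a derivative along the contour vanishes. -/
lemma hankelIntegral_deriv_eq_zero {a : ℝ} {G G' : ℂ → ℂ} (hG : ∀ w, HasDerivAt G (G' w) w)
    (hi : HankelIntegrable a G')
    (h1 : Tendsto (fun x : ℝ => G (x + (Real.pi : ℝ) * I)) atTop (𝓝 0))
    (h2 : Tendsto (fun x : ℝ => G (x + (-Real.pi : ℝ) * I)) atTop (𝓝 0)) :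
    hankelIntegral a G' = 0 := by
  have hx (y x : ℝ) : HasDerivAt (fun x : ℝ => G (x + y * I)) (G' (x + y * I)) x := by
    have := ((hasDerivAt_id (x : ℂ)).add_const (y * I)).comp_ofReal
    simpa [Function.comp_def] using (hG (x + y * I)).comp x this
  have hθ (θ : ℝ) : HasDerivAt (fun θ : ℝ => G (a + θ * I)) (G' (a + θ * I) * I) θ := by
    have := (((hasDerivAt_id (θ : ℂ)).mul_const I).const_add (a : ℂ)).comp_ofReal
    simpa [Function.comp_def] using (hG (a + θ * I)).comp θ this
  have e1 := intervalIntegral.integral_eq_sub_of_hasDerivAt (fun θ _ => hθ θ) (hi.1.mul_const I)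
  rw [intervalIntegral.integral_mul_const] at e1
  rw [hankelIntegral, integral_Ioi_of_hasDerivAt_of_tendsto' (fun x _ => hx _ x) hi.2.1 h1,
    integral_Ioi_of_hasDerivAt_of_tendsto' (fun x _ => hx _ x) hi.2.2 h2]
  linear_combination e1

/-- The integrand of the Hankel formula for `1 / Γ (s + 1)`, in logarithmic coordinates. -/
noncomputable def hankelKernel (s : ℝ) (w : ℂ) : ℂ := exp (exp w) * exp (-s * w)

lemma differentiable_hankelKernel (s : ℝ) : Differentiable ℂ (hankelKernel s) := by
  unfold hankelKernel; fun_prop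

lemma norm_hankelKernel (s : ℝ) (w : ℂ) :
    ‖hankelKernel s w‖ = ‖exp (exp w)‖ * Real.exp (-s * w.re) := by
  rw [hankelKernel, norm_mul, Complex.norm_exp (-s * w)]; simp

lemma hankelIntegrable_hankelKernel (a s : ℝ) : HankelIntegrable a (hankelKernel s) :=
  hankelIntegrable_of_le (C := 1) (c := -s)
    (fun w _ => (differentiable_hankelKernel s w).continuousAt)
    fun w _ => by rw [norm_hankelKernel, one_mul]

lemma hankelIntegral_hankelKernel_eq (s a b : ℝ) :
    hankelIntegral a (hankelKernel s) = hankelIntegral b (hankelKernel s) := by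
  have (a b : ℝ) (hab : a ≤ b) :
      hankelIntegral a (hankelKernel s) = hankelIntegral b (hankelKernel s) :=
    hankelIntegral_shift hab (fun w _ _ => differentiable_hankelKernel s w)
      (hankelIntegrable_hankelKernel a s)
  rcases le_total a b with h | h
  · exact this a b h
  · exact (this b a h).symm

lemma hankelKernel_top (s x : ℝ) : hankelKernel s (x + (Real.pi : ℝ) * I)
    = exp (-s * Real.pi * I) * (Real.exp (-Real.exp x) * Real.exp (-s * x) : ℝ) := by
  rw [hankelKernel, exp_exp_add_pi, mul_add, Complex.exp_add]
  push_cast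
  ring_nf

lemma hankelKernel_bottom (s x : ℝ) : hankelKernel s (x + (-Real.pi : ℝ) * I)
    = exp (s * Real.pi * I) * (Real.exp (-Real.exp x) * Real.exp (-s * x) : ℝ) := by
  rw [hankelKernel, exp_exp_sub_pi, mul_add, Complex.exp_add]
  push_cast
  ring_nf

lemma exp_neg_sub_exp_eq_sin (s : ℝ) :
    exp (-s * Real.pi * I) - exp (s * Real.pi * I) = 2 * I * (Real.sin (Real.pi * (-s)) : ℝ) := by
  rw [Complex.ofReal_sin, Complex.sin]
  push_cast
  ring_nf
  simp [sub_eq_add_neg]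

lemma hankelIntegral_hankelKernel (a s : ℝ) : hankelIntegral a (hankelKernel s)
    = I * (∫ θ in (-Real.pi)..Real.pi, hankelKernel s (a + θ * I))
      + 2 * I * (Real.sin (Real.pi * (-s)) : ℝ)
        * (∫ x in Ioi a, Real.exp (-Real.exp x) * Real.exp (-s * x) : ℝ) := by
  simp only [hankelIntegral, hankelKernel_top, hankelKernel_bottom, integral_const_mul,
    integral_complex_ofReal]
  rw [← exp_neg_sub_exp_eq_sin]
  ring

lemma hankelIntegral_hankelKernel_sub_one (a s : ℝ) :
    hankelIntegral a (hankelKernel (s - 1)) = s * hankelIntegral a (hankelKernel s) := by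
  have hd (w : ℂ) : HasDerivAt (hankelKernel s)
      (hankelKernel (s - 1) w + -s * hankelKernel s w) w := by
    have h1 := (Complex.hasDerivAt_exp w).cexp
    have h2 := ((hasDerivAt_id w).const_mul (-s : ℂ)).cexp
    refine (h1.mul h2).congr_deriv ?_
    have : exp (-((s - 1 : ℝ) : ℂ) * w) = exp w * exp (-s * w) := by
      rw [← Complex.exp_add]; push_cast; ring_nf
    simp only [hankelKernel, this, id]
    ring
  have hz : Tendsto (fun x : ℝ => ((Real.exp (-Real.exp x) * Real.exp (-s * x) : ℝ) : ℂ)) atTop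
      (𝓝 ((0 : ℝ) : ℂ)) :=
    (Complex.continuous_ofReal.tendsto 0).comp (tendsto_exp_neg_exp_mul_exp (-s))
  have h0 := hankelIntegral_deriv_eq_zero hd ((hankelIntegrable_hankelKernel a (s - 1)).add
    ((hankelIntegrable_hankelKernel a s).const_mul (-s)))
    (by simpa only [hankelKernel_top, Complex.ofReal_zero, mul_zero] using
      hz.const_mul (exp (-s * Real.pi * I)))
    (by simpa only [hankelKernel_bottom, Complex.ofReal_zero, mul_zero] using
      hz.const_mul (exp (s * Real.pi * I)))
  rw [hankelIntegral_add (hankelIntegrable_hankelKernel a (s - 1))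
    ((hankelIntegrable_hankelKernel a s).const_mul (-s)), hankelIntegral_const_mul] at h0
  linear_combination h0

lemma hankelIntegral_hankelKernel_of_neg (a : ℝ) {s : ℝ} (hs : -1 < s) (hs0 : s < 0) :
    hankelIntegral a (hankelKernel s) = 2 * Real.pi * I / (Real.Gamma (s + 1) : ℝ) := by
  have hleft : Tendsto (fun b : ℝ => ∫ θ in (-Real.pi)..Real.pi, hankelKernel s (b + θ * I))
      atBot (𝓝 0) := by
    have hlim : Tendsto (fun b : ℝ => Real.exp (Real.exp b) * Real.exp (-s * b)
        * |Real.pi - -Real.pi|) atBot (𝓝 0) := by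
      have h1 : Tendsto (fun b : ℝ => Real.exp (Real.exp b)) atBot (𝓝 (Real.exp 0)) :=
        (Real.continuous_exp.tendsto 0).comp Real.tendsto_exp_atBot
      have h2 : Tendsto (fun b : ℝ => Real.exp (-s * b)) atBot (𝓝 0) :=
        Real.tendsto_exp_atBot.comp (tendsto_id.const_mul_atBot (by linarith))
      simpa using (h1.mul h2).mul_const |Real.pi - -Real.pi|
    refine squeeze_zero_norm (fun b => ?_) hlim
    refine intervalIntegral.norm_integral_le_of_norm_le_const fun θ _ => ?_
    rw [norm_hankelKernel]
    have := norm_exp_exp_le (b + θ * I)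
    simp only [add_re, ofReal_re, mul_re, I_re, mul_zero, ofReal_im, I_im, mul_one, sub_self,
      add_zero] at this ⊢
    gcongr
  have hright : Tendsto (fun b : ℝ => ∫ x in Ioi b, Real.exp (-Real.exp x) * Real.exp (-s * x))
      atBot (𝓝 (Real.Gamma (-s))) := by
    have hcov : AECover (volume.restrict (Ioi (0 : ℝ))) atBot fun b : ℝ => Ioi (Real.exp b) :=
      aecover_Ioi_of_Ioi Real.tendsto_exp_atBot
    have hG := hcov.integral_tendsto_of_countably_generated
      (Real.GammaIntegral_convergent (s := -s) (by linarith))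
    rw [← Real.Gamma_eq_integral (by linarith)] at hG
    refine hG.congr fun b => ?_
    rw [Measure.restrict_restrict measurableSet_Ioi,
      inter_eq_left.2 (Ioi_subset_Ioi (Real.exp_nonneg b)), ← integral_comp_exp_Ioi]
    refine integral_congr_ae (Eventually.of_forall fun x => ?_)
    simp only [smul_eq_mul]
    rw [← Real.exp_mul, mul_left_comm, ← Real.exp_add]
    ring_nf
  have hlim : Tendsto (fun b => hankelIntegral b (hankelKernel s)) atBot
      (𝓝 (I * 0 + 2 * I * (Real.sin (Real.pi * (-s)) : ℝ) * (Real.Gamma (-s) : ℝ))) := by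
    simp only [hankelIntegral_hankelKernel _ s]
    exact (hleft.const_mul I).add
      (((Complex.continuous_ofReal.tendsto _).comp hright).const_mul _)
  have heq := tendsto_nhds_unique (tendsto_const_nhds.congr
    fun b => hankelIntegral_hankelKernel_eq s a b) hlim
  rw [heq]
  have hrefl := Real.Gamma_mul_Gamma_one_sub (-s)
  have hsin : Real.sin (Real.pi * (-s)) ≠ 0 :=
    (Real.sin_pos_of_pos_of_lt_pi (mul_pos Real.pi_pos (by linarith))
      (by nlinarith [Real.pi_pos])).ne'
  rw [eq_div_iff hsin, sub_neg_eq_add, add_comm 1 s] at hrefl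
  have hΓ : ((Real.Gamma (s + 1) : ℝ) : ℂ) ≠ 0 :=
    Complex.ofReal_ne_zero.2 (Real.Gamma_pos_of_pos (by linarith)).ne'
  rw [eq_div_iff hΓ]
  have := congrArg (fun x : ℝ => (x : ℂ)) hrefl
  push_cast at this ⊢
  linear_combination 2 * I * this

lemma hankelIntegral_hankelKernel_zero (a : ℝ) :
    hankelIntegral a (hankelKernel 0) = 2 * Real.pi * I := by
  have hleft : Tendsto (fun b : ℝ => (∫ θ in (-Real.pi)..Real.pi, hankelKernel 0 (b + θ * I))
      - 2 * Real.pi) atBot (𝓝 0) := by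
    have hlim : Tendsto (fun b : ℝ => 2 * Real.exp b * |Real.pi - -Real.pi|) atBot (𝓝 0) := by
      simpa using (Real.tendsto_exp_atBot.const_mul 2).mul_const |Real.pi - -Real.pi|
    refine squeeze_zero_norm' ?_ hlim
    filter_upwards [eventually_le_atBot 0] with b hb
    have hc : ∫ _ in (-Real.pi)..Real.pi, (1 : ℂ) = 2 * Real.pi := by
      simp; ring
    rw [← hc, ← intervalIntegral.integral_sub (hankelIntegrable_hankelKernel b 0).1 (by simp)]
    refine intervalIntegral.norm_integral_le_of_norm_le_const fun θ _ => ?_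
    have hn : ‖exp (b + θ * I)‖ = Real.exp b := by simp [Complex.norm_exp]
    have := Complex.norm_exp_sub_one_le (x := exp (b + θ * I))
      (by rw [hn]; exact Real.exp_le_one_iff.2 hb)
    rw [hn] at this
    simpa [hankelKernel] using this
  have hlim : Tendsto (fun b => hankelIntegral b (hankelKernel 0)) atBot
      (𝓝 (I * (0 + 2 * Real.pi))) := by
    refine ((hleft.add_const (2 * Real.pi : ℂ)).const_mul I).congr fun b => ?_
    rw [hankelIntegral_hankelKernel]
    simp
  rw [tendsto_nhds_unique (tendsto_const_nhds.congr
    fun b => hankelIntegral_hankelKernel_eq 0 a b) hlim]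
  ring

/-- The **Hankel formula** for the reciprocal Gamma function. -/
lemma hankelIntegral_hankelKernel_eq_inv_Gamma (a : ℝ) {s : ℝ} (hs : -1 < s) :
    hankelIntegral a (hankelKernel s) = 2 * Real.pi * I / (Real.Gamma (s + 1) : ℝ) := by
  obtain ⟨n, hn⟩ := exists_nat_ge s
  induction n generalizing s with
  | zero =>
    rcases lt_or_eq_of_le hn with h | h
    · exact hankelIntegral_hankelKernel_of_neg a hs (by simpa using h)
    · rw [Nat.cast_zero] at h
      subst h
      simp [hankelIntegral_hankelKernel_zero]
  | succ n ih =>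
    rcases le_or_gt s 0 with h0 | h0
    · exact ih hs (h0.trans n.cast_nonneg)
    · push_cast at hn
      have h1 := ih (s := s - 1) (by linarith) (by linarith)
      rw [hankelIntegral_hankelKernel_sub_one, sub_add_cancel] at h1
      rw [Real.Gamma_add_one h0.ne', Complex.ofReal_mul]
      have hs' : (s : ℂ) ≠ 0 := Complex.ofReal_ne_zero.2 h0.ne'
      have hΓ : ((Real.Gamma s : ℝ) : ℂ) ≠ 0 :=
        Complex.ofReal_ne_zero.2 (Real.Gamma_pos_of_pos h0).ne'
      rw [eq_div_iff hΓ] at h1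
      rw [eq_div_iff (mul_ne_zero hs' hΓ)]
      linear_combination h1

/-- Termwise integration of a geometric series along the contour. -/
lemma hasSum_hankelIntegral_geometric {a ρ : ℝ} (hρ : ρ < 1) {z : ℂ → ℂ} (hz : Continuous z)
    (hb : ∀ w ∈ hankelContour a, ‖z w‖ ≤ ρ) :
    HasSum (fun k : ℕ => hankelIntegral a fun w => exp (exp w) * z w ^ k)
      (hankelIntegral a fun w => exp (exp w) / (1 - z w)) := by
  have hρ0 : 0 ≤ ρ := (norm_nonneg _).trans (hb a (by simp [hankelContour, Real.pi_pos.le]))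
  have hne (w) (hw : w ∈ hankelContour a) : 1 - z w ≠ 0 := fun h => by
    have := hb w hw
    rw [← sub_eq_zero.1 h, norm_one] at this
    linarith
  have hsub (w) (hw : w ∈ hankelContour a) : 1 - ρ ≤ ‖1 - z w‖ := by
    have := norm_sub_norm_le 1 (z w)
    rw [norm_one] at this
    linarith [hb w hw]
  have hterm (k : ℕ) (w) (hw : w ∈ hankelContour a) :
      ‖exp (exp w) * z w ^ k‖ ≤ ρ ^ k * (‖exp (exp w)‖ * Real.exp (0 * w.re)) := by
    rw [norm_mul, norm_pow, zero_mul, Real.exp_zero, mul_one, mul_comm]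
    gcongr
    exact hb w hw
  have hrem (k : ℕ) (w) (hw : w ∈ hankelContour a) : ‖exp (exp w) * z w ^ k / (1 - z w)‖
      ≤ ρ ^ k / (1 - ρ) * (‖exp (exp w)‖ * Real.exp (0 * w.re)) := by
    rw [norm_div, div_mul_eq_mul_div]
    gcongr
    exacts [hterm k w hw, hsub w hw]
  have hti (k : ℕ) : HankelIntegrable a fun w => exp (exp w) * z w ^ k :=
    hankelIntegrable_of_le (fun w _ => by fun_prop) (hterm k)
  have hri (k : ℕ) : HankelIntegrable a fun w => exp (exp w) * z w ^ k / (1 - z w) :=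
    hankelIntegrable_of_le
      (fun w hw => ContinuousAt.div (by fun_prop) (by fun_prop) (hne w hw)) (hrem k)
  have hpartial (n : ℕ) : hankelIntegral a (fun w => exp (exp w) / (1 - z w))
      = (∑ k ∈ Finset.range n, hankelIntegral a fun w => exp (exp w) * z w ^ k)
        + hankelIntegral a fun w => exp (exp w) * z w ^ n / (1 - z w) := by
    induction n with
    | zero => simp
    | succ n ih =>
      rw [ih, Finset.sum_range_succ, add_assoc, ← hankelIntegral_add (hti n) (hri (n + 1))]
      congr 1
      refine hankelIntegral_congr fun w hw => ?_
      have := hne w hw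
      field_simp
      ring
  have hsum : Summable fun k : ℕ => hankelIntegral a fun w => exp (exp w) * z w ^ k :=
    Summable.of_norm_bounded ((summable_geometric_of_lt_one hρ0 hρ).mul_right (hankelBound a 0))
      fun k => norm_hankelIntegral_le (pow_nonneg hρ0 k) (hterm k)
  rw [hsum.hasSum_iff_tendsto_nat, tendsto_iff_norm_sub_tendsto_zero]
  have hlim : Tendsto (fun n : ℕ => ρ ^ n / (1 - ρ) * hankelBound a 0) atTop (𝓝 0) := by
    simpa using ((tendsto_pow_atTop_nhds_zero_of_lt_one hρ0 hρ).div_const (1 - ρ)).mul_const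
      (hankelBound a 0)
  refine squeeze_zero (fun n => norm_nonneg _) (fun n => ?_) hlim
  rw [hpartial n, sub_add_cancel_left, norm_neg]
  exact norm_hankelIntegral_le (div_nonneg (pow_nonneg hρ0 n) (by linarith)) (hrem n)

/-- The integrand representing `E_β (exp (β * L))`. -/
noncomputable def mittagLefflerKernel (β L : ℝ) (w : ℂ) : ℂ :=
  exp (exp w) / (1 - exp (-β * (w - L)))

lemma norm_exp_neg_mul_sub (β L : ℝ) (w : ℂ) :
    ‖exp (-β * (w - L))‖ = Real.exp (-β * (w.re - L)) := by
  rw [Complex.norm_exp]; simp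

section Right

variable {β L a : ℝ}

lemma norm_exp_neg_mul_sub_le (hβ : 0 < β) {w : ℂ} (hw : w ∈ hankelContour a) :
    ‖exp (-β * (w - L))‖ ≤ Real.exp (-β * (a - L)) := by
  rw [norm_exp_neg_mul_sub, Real.exp_le_exp]
  nlinarith [hw.1]

lemma exp_neg_mul_sub_lt_one (hβ : 0 < β) (ha : L < a) : Real.exp (-β * (a - L)) < 1 :=
  Real.exp_zero ▸ Real.exp_lt_exp.2 (by nlinarith)

lemma hankelIntegrable_mittagLefflerKernel_right (hβ : 0 < β) (ha : L < a) :
    HankelIntegrable a (mittagLefflerKernel β L) := by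
  have hρ := exp_neg_mul_sub_lt_one hβ ha
  have hsub (w) (hw : w ∈ hankelContour a) :
      1 - Real.exp (-β * (a - L)) ≤ ‖1 - exp (-β * (w - L))‖ := by
    have := norm_sub_norm_le 1 (exp (-β * (w - L)))
    rw [norm_one] at this
    linarith [norm_exp_neg_mul_sub_le (L := L) hβ hw]
  refine hankelIntegrable_of_le (C := (1 - Real.exp (-β * (a - L)))⁻¹) (c := 0)
    (fun w hw => ContinuousAt.div (by fun_prop) (by fun_prop) ?_) fun w hw => ?_
  · exact norm_pos_iff.1 ((sub_pos.2 hρ).trans_le (hsub w hw))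
  · rw [mittagLefflerKernel, norm_div, zero_mul, Real.exp_zero, mul_one, div_eq_inv_mul]
    gcongr
    exact hsub w hw

lemma hankelIntegral_mittagLefflerKernel_right (hβ : 0 < β) (ha : L < a) :
    hankelIntegral a (mittagLefflerKernel β L)
      = 2 * Real.pi * I * (mittagLeffler β (Real.exp (β * L)) : ℝ) := by
  have h := hasSum_hankelIntegral_geometric (a := a) (exp_neg_mul_sub_lt_one hβ ha)
    (z := fun w => exp (-β * (w - L))) (by fun_prop) fun w hw => norm_exp_neg_mul_sub_le hβ hw
  have hterm (k : ℕ) : hankelIntegral a (fun w => exp (exp w) * exp (-β * (w - L)) ^ k)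
      = 2 * Real.pi * I
        * ((Real.exp (β * L) ^ k / Real.Gamma (β * (k : ℝ) + 1) : ℝ) : ℂ) := by
    have he : (fun w : ℂ => exp (exp w) * exp (-β * (w - L)) ^ k)
        = fun w => ((Real.exp (β * L) ^ k : ℝ) : ℂ) * hankelKernel (β * k) w := by
      funext w
      have : exp (-β * (w - L)) ^ k
          = ((Real.exp (β * L) ^ k : ℝ) : ℂ) * exp (-(β * k : ℝ) * w) := by
        rw [Complex.ofReal_pow, Complex.ofReal_exp, ← Complex.exp_nat_mul, ← Complex.exp_nat_mul,
          ← Complex.exp_add]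
        push_cast
        ring_nf
      rw [this, hankelKernel]
      ring
    rw [he, hankelIntegral_const_mul, hankelIntegral_hankelKernel_eq_inv_Gamma a
      (by have : 0 ≤ β * k := by positivity
          linarith)]
    push_cast
    ring
  simp only [hterm] at h
  have htsum := h.tsum_eq
  rw [tsum_mul_left, ← Complex.ofReal_tsum] at htsum
  exact htsum.symm

end Right

lemma mittagLeffler_one (x : ℝ) : mittagLeffler 1 x = Real.exp x := by
  rw [mittagLeffler, Real.exp_eq_exp_ℝ, NormedSpace.exp_eq_tsum_div]
  simp [Real.Gamma_nat_eq_factorial]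

/-- The denominator of the kernel stays comparable to its exponential term along the contour with
left end on the imaginary axis. -/
lemma exists_mul_norm_le_norm_one_sub {β : ℝ} (hβ : 0 < β) (hβ1 : β ≤ 1) :
    ∃ c > 0, ∀ᶠ L : ℝ in atTop, ∀ w ∈ hankelContour 0,
      c * ‖exp (-β * (w - L))‖ ≤ ‖1 - exp (-β * (w - L))‖ := by
  obtain ⟨c, hc, hcb⟩ : ∃ c > 0, ∀ (w : ℂ) (L : ℝ), |w.im| = Real.pi →
      c * ‖exp (-β * (w - L))‖ ≤ ‖1 - exp (-β * (w - L))‖ := by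
    rcases lt_or_eq_of_le hβ1 with h | rfl
    · have hsin : 0 < Real.sin (β * Real.pi) :=
        Real.sin_pos_of_pos_of_lt_pi (by positivity) (by nlinarith [Real.pi_pos])
      refine ⟨_, hsin, fun w L hw => le_trans ?_ (Complex.abs_im_le_norm _)⟩
      rw [norm_exp_neg_mul_sub]
      have : |Real.sin (β * w.im)| = Real.sin (β * Real.pi) := by
        rcases eq_or_eq_neg_of_abs_eq hw with h | h <;> simp [h, abs_of_pos hsin]
      simp [Complex.exp_im, abs_mul, this, mul_comm]
    · refine ⟨1, one_pos, fun w L hw => le_trans ?_ (Complex.re_le_norm _)⟩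
      rw [norm_exp_neg_mul_sub]
      have : Real.cos w.im = -1 := by
        rw [← Real.cos_abs, hw, Real.cos_pi]
      simp [Complex.exp_re, this]
  refine ⟨min c (1 / 2), by positivity, ?_⟩
  filter_upwards [eventually_ge_atTop (Real.log 2 / β)] with L hL w hw
  rcases hw.2.2 with h | h
  · have h2 : 2 ≤ ‖exp (-β * (w - L))‖ := by
      rw [norm_exp_neg_mul_sub, h, ← Real.log_le_iff_le_exp two_pos]
      rw [div_le_iff₀ hβ] at hL
      linarith
    have h3 := norm_sub_norm_le (exp (-β * (w - L))) 1
    rw [norm_one, norm_sub_rev] at h3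
    nlinarith [min_le_right c (1 / 2)]
  · exact (mul_le_mul_of_nonneg_right (min_le_left _ _) (norm_nonneg _)).trans (hcb w L h)

lemma exists_norm_hankelIntegral_mittagLefflerKernel_le {β : ℝ} (hβ : 0 < β) (hβ1 : β ≤ 1) :
    ∃ C, ∀ᶠ L : ℝ in atTop, HankelIntegrable 0 (mittagLefflerKernel β L) ∧
      ‖hankelIntegral 0 (mittagLefflerKernel β L)‖ ≤ C * Real.exp (-β * L) := by
  obtain ⟨c, hc, h⟩ := exists_mul_norm_le_norm_one_sub hβ hβ1
  refine ⟨c⁻¹ * hankelBound 0 β, h.mono fun L hL => ?_⟩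
  have hpos (w) (hw : w ∈ hankelContour 0) : 0 < ‖1 - exp (-β * (w - L))‖ :=
    (mul_pos hc (norm_pos_iff.2 (Complex.exp_ne_zero _))).trans_le (hL w hw)
  have hb (w) (hw : w ∈ hankelContour 0) : ‖mittagLefflerKernel β L w‖
      ≤ c⁻¹ * Real.exp (-β * L) * (‖exp (exp w)‖ * Real.exp (β * w.re)) := by
    rw [mittagLefflerKernel, norm_div, div_le_iff₀ (hpos w hw)]
    calc ‖exp (exp w)‖ = c⁻¹ * Real.exp (-β * L) * (‖exp (exp w)‖ * Real.exp (β * w.re))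
          * (c * ‖exp (-β * (w - L))‖) := by
          have : Real.exp (-β * L) * Real.exp (β * w.re) * Real.exp (-β * (w.re - L)) = 1 := by
            rw [← Real.exp_add, ← Real.exp_add, Real.exp_eq_one_iff]; ring
          rw [norm_exp_neg_mul_sub]
          linear_combination -‖exp (exp w)‖ * this - ‖exp (exp w)‖ * Real.exp (-β * L)
            * Real.exp (β * w.re) * Real.exp (-β * (w.re - L)) * inv_mul_cancel₀ hc.ne'
      _ ≤ _ := by gcongr; exact hL w hw
  refine ⟨hankelIntegrable_of_le (fun w hw => ContinuousAt.div (by fun_prop) (by fun_prop)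
    (norm_pos_iff.1 (hpos w hw))) hb, (norm_hankelIntegral_le (by positivity) hb).trans_eq ?_⟩
  ring

/-- The entire function with `w * D w = 1 - exp (-β * w)`. -/
noncomputable def oneSubExpDivSelf (β : ℝ) : ℂ → ℂ := dslope (fun w => 1 - exp (-β * w)) 0

lemma differentiable_oneSubExpDivSelf (β : ℝ) : Differentiable ℂ (oneSubExpDivSelf β) :=
  differentiableOn_univ.1 <| (Complex.differentiableOn_dslope univ_mem).2 <|
    Differentiable.differentiableOn (by fun_prop)

lemma oneSubExpDivSelf_zero (β : ℝ) : oneSubExpDivSelf β 0 = β := by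
  rw [oneSubExpDivSelf, dslope_same]
  have h := (((hasDerivAt_id (0 : ℂ)).const_mul (-β : ℂ)).cexp).const_sub 1
  simpa using h.deriv

lemma oneSubExpDivSelf_of_ne (β : ℝ) {w : ℂ} (hw : w ≠ 0) :
    oneSubExpDivSelf β w = (1 - exp (-β * w)) / w := by
  rw [oneSubExpDivSelf, dslope_of_ne _ hw, slope_def_field]
  simp

lemma oneSubExpDivSelf_ne_zero {β : ℝ} (hβ : 0 < β) (hβ1 : β ≤ 1) {w : ℂ}
    (hw : |w.im| < 2 * Real.pi) : oneSubExpDivSelf β w ≠ 0 := by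
  rcases eq_or_ne w 0 with rfl | h0
  · rw [oneSubExpDivSelf_zero]
    exact_mod_cast hβ.ne'
  · rw [oneSubExpDivSelf_of_ne β h0]
    refine div_ne_zero (fun h => h0 ?_) h0
    obtain ⟨n, hn⟩ := Complex.exp_eq_one_iff.1 (sub_eq_zero.1 h).symm
    have him : -(β * w.im) = n * (2 * Real.pi) := by simpa using congrArg Complex.im hn
    have hlt : |(n : ℝ)| * (2 * Real.pi) < 1 * (2 * Real.pi) := by
      have := congrArg abs him
      rw [abs_neg, abs_mul, abs_mul, abs_of_pos hβ, abs_of_pos Real.two_pi_pos] at this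
      rw [← this]
      nlinarith [abs_nonneg w.im]
    have hn0 : n = 0 := by
      have := lt_of_mul_lt_mul_right hlt Real.two_pi_pos.le
      exact Int.abs_lt_one_iff.1 (by exact_mod_cast this)
    rw [hn0, Int.cast_zero, zero_mul] at hn
    have hβ' : (-β : ℂ) ≠ 0 := neg_ne_zero.2 (by exact_mod_cast hβ.ne')
    exact (mul_eq_zero.1 hn).resolve_left hβ'

/-- The simple pole of the kernel at `L` is removed by subtracting a multiple of the kernel of the
exponential function. -/
lemma exists_differentiable_eq_mittagLefflerKernel_sub {α : ℝ} (hα : 0 < α) (hα1 : α ≤ 1) (L : ℝ) :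
    ∃ G : ℂ → ℂ, (∀ w : ℂ, |w.im| ≤ Real.pi → DifferentiableAt ℂ G w) ∧ ∀ w : ℂ, w ≠ L →
      mittagLefflerKernel α L w + -(1 / α : ℂ) * mittagLefflerKernel 1 L w = G w := by
  set ψ : ℂ → ℂ := fun w => (oneSubExpDivSelf α w)⁻¹ - (1 / α : ℂ) * (oneSubExpDivSelf 1 w)⁻¹
    with hψ
  set S : Set ℂ := {w | |w.im| < 2 * Real.pi} with hS
  have hSo : IsOpen S := isOpen_lt (by fun_prop) continuous_const
  have hψd : DifferentiableOn ℂ (dslope ψ 0) S := by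
    refine (Complex.differentiableOn_dslope (hSo.mem_nhds (by simp [hS, Real.pi_pos]))).2 ?_
    exact ((differentiable_oneSubExpDivSelf α).differentiableOn.inv
      fun w hw => oneSubExpDivSelf_ne_zero hα hα1 hw).sub
      (((differentiable_oneSubExpDivSelf 1).differentiableOn.inv
        fun w hw => oneSubExpDivSelf_ne_zero one_pos le_rfl hw).const_mul _)
  refine ⟨fun w => exp (exp w) * dslope ψ 0 (w - L), fun w hw => ?_, fun w hw => ?_⟩
  · have hmem : w - L ∈ S := by
      simp only [hS, mem_ofPred_eq, sub_im, ofReal_im, sub_zero]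
      linarith [Real.pi_pos]
    exact DifferentiableAt.mul (by fun_prop)
      ((hψd.differentiableAt (hSo.mem_nhds hmem)).comp w (by fun_prop))
  · have h0 : w - L ≠ 0 := sub_ne_zero.2 hw
    have hψ0 : ψ 0 = 0 := by simp [hψ, oneSubExpDivSelf_zero]
    beta_reduce
    rw [dslope_of_ne _ h0, slope_def_field, hψ0, sub_zero, sub_zero]
    simp only [hψ, oneSubExpDivSelf_of_ne _ h0, mittagLefflerKernel, inv_div]
    rw [sub_div, mul_div_assoc, div_right_comm, div_self h0, div_right_comm _ _ (w - L),
      div_self h0]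
    ring

lemma exists_abs_mittagLeffler_exp_sub_le {α : ℝ} (hα : 0 < α) (hα1 : α ≤ 1) :
    ∃ C, ∀ᶠ L : ℝ in atTop,
      |mittagLeffler α (Real.exp (α * L)) - (1 / α) * Real.exp (Real.exp L)|
        ≤ C * Real.exp (-α * L) := by
  obtain ⟨A, hA⟩ := exists_norm_hankelIntegral_mittagLefflerKernel_le hα hα1
  obtain ⟨B, hB⟩ := exists_norm_hankelIntegral_mittagLefflerKernel_le one_pos le_rfl
  refine ⟨(A + (1 / α) * |B|) / (2 * Real.pi), ?_⟩
  filter_upwards [hA, hB, eventually_gt_atTop 0] with L ⟨hAi, hAL⟩ ⟨hBi, hBL⟩ hL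
  obtain ⟨G, hGd, hG⟩ := exists_differentiable_eq_mittagLefflerKernel_sub hα hα1 L
  have hmem {a : ℝ} (ha : a ≠ L) : EqOn
      (fun w => mittagLefflerKernel α L w + -(1 / α : ℂ) * mittagLefflerKernel 1 L w) G
      (hankelContour a) := fun w hw => hG w (by
    rintro rfl
    rcases hw.2.2 with h | h
    · exact ha (by simpa using h.symm)
    · simp [Real.pi_ne_zero.symm] at h)
  have hlt : L < L + 1 := by linarith
  have hshift : hankelIntegral 0 G = hankelIntegral (L + 1) G :=
    hankelIntegral_shift (by linarith) (fun w _ hw => hGd w hw)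
      ((hAi.add (hBi.const_mul _)).congr (hmem hL.ne))
  rw [← hankelIntegral_congr (hmem hL.ne), ← hankelIntegral_congr (hmem hlt.ne'),
    hankelIntegral_add hAi (hBi.const_mul _), hankelIntegral_const_mul,
    hankelIntegral_add (hankelIntegrable_mittagLefflerKernel_right hα hlt)
      ((hankelIntegrable_mittagLefflerKernel_right one_pos hlt).const_mul _),
    hankelIntegral_const_mul, hankelIntegral_mittagLefflerKernel_right hα hlt,
    hankelIntegral_mittagLefflerKernel_right one_pos hlt, mittagLeffler_one, one_mul] at hshift
  have hnorm : 2 * Real.pi * |mittagLeffler α (Real.exp (α * L)) - (1 / α) * Real.exp (Real.exp L)|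
      = ‖hankelIntegral 0 (mittagLefflerKernel α L)
        + -(1 / α : ℂ) * hankelIntegral 0 (mittagLefflerKernel 1 L)‖ := by
    rw [hshift, ← Real.norm_eq_abs, ← Complex.norm_real]
    have : (2 * Real.pi : ℝ) = ‖(2 * Real.pi * I : ℂ)‖ := by
      simp [abs_of_pos Real.pi_pos]
    rw [this, ← norm_mul]
    push_cast
    ring_nf
  have hexp : B * Real.exp (-1 * L) ≤ |B| * Real.exp (-α * L) :=
    mul_le_mul (le_abs_self B) (Real.exp_le_exp.2 (by nlinarith)) (Real.exp_nonneg _)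
      (abs_nonneg B)
  have hle := norm_add_le (hankelIntegral 0 (mittagLefflerKernel α L))
    (-(1 / α : ℂ) * hankelIntegral 0 (mittagLefflerKernel 1 L))
  rw [← hnorm, norm_mul, norm_neg, norm_div, norm_one, Complex.norm_real, Real.norm_of_nonneg hα.le]
    at hle
  rw [div_mul_eq_mul_div (A + _), le_div_iff₀ Real.two_pi_pos]
  have := mul_le_mul_of_nonneg_left (hBL.trans hexp) (one_div_nonneg.2 hα.le)
  linarith

/-- For `α ∈ (0,1]` and `λ > 0`, as `t → ∞`,
`E_α(λ t^α) = (1/α)·exp(λ^{1/α} t) + O(t^{-α})`;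
in particular `E_α(λ t^α)` grows (exponentially) towards `∞`. -/
theorem mittagLeffler_asymptotic_pos (α lam : ℝ) (hα : 0 < α) (hα1 : α ≤ 1)
    (hlam : 0 < lam) :
    ((fun t : ℝ => mittagLeffler α (lam * t ^ α)
        - (1 / α) * Real.exp (lam ^ (1 / α) * t)) =O[Filter.atTop]
      fun t : ℝ => t ^ (-α)) ∧
    Filter.Tendsto (fun t : ℝ => mittagLeffler α (lam * t ^ α))
      Filter.atTop Filter.atTop := by
  have hO : (fun t : ℝ => mittagLeffler α (lam * t ^ α)
      - (1 / α) * Real.exp (lam ^ (1 / α) * t)) =O[atTop] fun t : ℝ => t ^ (-α) := by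
    obtain ⟨C, hC⟩ := exists_abs_mittagLeffler_exp_sub_le hα hα1
    have htend : Tendsto (fun t : ℝ => Real.log (lam ^ (1 / α) * t)) atTop atTop :=
      Real.tendsto_log_atTop.comp (tendsto_id.const_mul_atTop (by positivity))
    refine Asymptotics.IsBigO.of_bound (C * lam⁻¹) ?_
    filter_upwards [htend.eventually hC, eventually_gt_atTop 0] with t ht ht0
    have hs : 0 < lam ^ (1 / α) * t := by positivity
    have hpow : (lam ^ (1 / α) * t) ^ α = lam * t ^ α := by
      rw [Real.mul_rpow (by positivity) ht0.le, ← Real.rpow_mul hlam.le, one_div,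
        inv_mul_cancel₀ hα.ne', Real.rpow_one]
    rw [neg_mul, Real.exp_neg, mul_comm α, ← Real.rpow_def_of_pos hs, Real.exp_log hs, hpow] at ht
    rw [Real.norm_eq_abs, Real.norm_of_nonneg (Real.rpow_nonneg ht0.le _), Real.rpow_neg ht0.le]
    rwa [mul_inv, ← mul_assoc] at ht
  refine ⟨hO, ?_⟩
  have hexp : Tendsto (fun t : ℝ => (1 / α) * Real.exp (lam ^ (1 / α) * t)) atTop atTop :=
    (Real.tendsto_exp_atTop.comp (tendsto_id.const_mul_atTop (by positivity))).const_mul_atTop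
      (by positivity)
  refine ((hO.trans_tendsto (tendsto_rpow_neg_atTop hα)).add_atTop hexp).congr fun t => ?_
  ring
end

section
/- Let α ∈ (0,1], T > 0, and let f : [0,T] × ℝ → ℝ be continuous and satisfy the Lipschitz condition. Let x₁ and x₂ be solutions on [0,T] of the Caputo fractional initial value problems with the same f and initial values x₁(0) = x₁₀ and x₂(0) = x₂₀ where x₁₀ ≠ x₂₀. Then the trajectories of the two solutions do not meet: x₁(t) ≠ x₂(t) for all t ∈ [0,T]. -/
open Set intervalIntegral

/-- A continuous function `x` on `[0,T]` solves the Caputo fractional initial value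
problem `^C D^α_{0+} x(t) = f(t,x(t))`, `x(0) = x₀`, in the equivalent Volterra
integral formulation. -/
def IsCaputoSolution (α T : ℝ) (f : ℝ → ℝ → ℝ) (x₀ : ℝ) (x : ℝ → ℝ) : Prop :=
  ContinuousOn x (Set.Icc 0 T) ∧
    ∀ t ∈ Set.Icc 0 T,
      x t = x₀ + (1 / Real.Gamma α) * ∫ s in (0:ℝ)..t, (t - s) ^ (α - 1) * f s (x s)

section AbelKernel

open MeasureTheory Real

/-- The kernel `v ^ (α - 1)`, extended by zero to `v ≤ 0`. -/
noncomputable def abelKernel (α v : ℝ) : ℝ := (Ioi 0).indicator (fun v => v ^ (α - 1)) v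

/-- The constant `∫ v in Ioi 0, v ^ (α - 1) / (v + 1)`. -/
noncomputable def abelConst (α : ℝ) : ℝ := ∫ v in Ioi 0, rpowIntegrand₀₁ α v 1

lemma abelKernel_of_pos {α v : ℝ} (hv : 0 < v) : abelKernel α v = v ^ (α - 1) :=
  indicator_of_mem (mem_Ioi.2 hv) _

lemma abelKernel_of_nonpos {α v : ℝ} (hv : v ≤ 0) : abelKernel α v = 0 :=
  indicator_of_notMem (notMem_Ioi.2 hv) _

lemma abelKernel_nonneg (α v : ℝ) : 0 ≤ abelKernel α v :=
  indicator_nonneg (fun _ hx => rpow_nonneg (le_of_lt hx) _) v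

lemma measurable_abelKernel (α : ℝ) : Measurable (abelKernel α) :=
  Measurable.indicator (by fun_prop) measurableSet_Ioi

lemma rpow_div_affine_eqOn {α a b : ℝ} (hα : α ∈ Ioo (0 : ℝ) 1) (ha : 0 < a) (hb : 0 < b) :
    EqOn (fun v : ℝ => b⁻¹ * rpowIntegrand₀₁ α v (b / a))
      (fun v => v ^ (α - 1) / (a * v + b)) (Ioi 0) := by
  intro v hv
  have hv' : (0 : ℝ) < v := hv
  have h1 : a * v + b ≠ 0 := by positivity
  have h2 : v + b / a ≠ 0 := by positivity
  simp only [rpowIntegrand₀₁_eq_pow_div hα hv'.le (div_pos hb ha).le]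
  field_simp

lemma integrableOn_rpow_div_affine {α a b : ℝ} (hα : α ∈ Ioo (0 : ℝ) 1)
    (ha : 0 < a) (hb : 0 < b) :
    IntegrableOn (fun v : ℝ => v ^ (α - 1) / (a * v + b)) (Ioi 0) :=
  IntegrableOn.congr_fun
    ((integrableOn_rpowIntegrand₀₁_Ioi hα (div_pos hb ha).le).const_mul b⁻¹)
    (rpow_div_affine_eqOn hα ha hb) measurableSet_Ioi

lemma integral_rpow_div_affine {α a b : ℝ} (hα : α ∈ Ioo (0 : ℝ) 1) (ha : 0 < a) (hb : 0 < b) :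
    ∫ v in Ioi (0 : ℝ), v ^ (α - 1) / (a * v + b) = abelConst α * a ^ (-α) * b ^ (α - 1) := by
  rw [← setIntegral_congr_fun measurableSet_Ioi (rpow_div_affine_eqOn hα ha hb),
    MeasureTheory.integral_const_mul, integral_rpowIntegrand₀₁_eq_rpow_mul_const hα (div_pos hb ha).le,
    div_rpow hb.le ha.le, rpow_sub_one hb.ne', rpow_neg ha.le, abelConst]
  ring

lemma abelKernel_div_eq_indicator {α r d : ℝ} (hr : 0 < r) :
    (fun w => abelKernel α (w * r - 1) / (d * w + 1)) =
      fun w => (Ioi 0).indicator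
        (fun v => r ^ (α - 1) * (v ^ (α - 1) / (d * v + (d + r) / r))) (w - 1 / r) := by
  ext w
  by_cases hw : 0 < w - 1 / r
  · have h1 : w * r - 1 = r * (w - 1 / r) := by field_simp
    rw [indicator_of_mem (mem_Ioi.2 hw), h1, abelKernel_of_pos (by positivity),
      mul_rpow hr.le hw.le, mul_div_assoc]
    congr 2
    field_simp
    ring
  · have h1 : w * r - 1 = r * (w - 1 / r) := by field_simp
    rw [indicator_of_notMem (notMem_Ioi.2 (not_lt.1 hw)), h1,
      abelKernel_of_nonpos (mul_nonpos_of_nonneg_of_nonpos hr.le (not_lt.1 hw)), zero_div]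

lemma integrable_abelKernel_div {α r d : ℝ} (hα : α ∈ Ioo (0 : ℝ) 1) (hr : 0 < r) (hd : 0 < d) :
    Integrable (fun w => abelKernel α (w * r - 1) / (d * w + 1)) := by
  rw [abelKernel_div_eq_indicator hr]
  exact (IntegrableOn.integrable_indicator
    ((integrableOn_rpow_div_affine hα hd (by positivity)).const_mul _)
    measurableSet_Ioi).comp_sub_right (1 / r)

lemma integral_abelKernel_div {α r d : ℝ} (hα : α ∈ Ioo (0 : ℝ) 1) (hr : 0 < r) (hd : 0 < d) :
    ∫ w, abelKernel α (w * r - 1) / (d * w + 1) =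
      abelConst α * d ^ (-α) * (d + r) ^ (α - 1) := by
  rw [abelKernel_div_eq_indicator hr,
    integral_sub_right_eq_self (fun w => (Ioi (0 : ℝ)).indicator
        (fun v => r ^ (α - 1) * (v ^ (α - 1) / (d * v + (d + r) / r))) w),
    MeasureTheory.integral_indicator measurableSet_Ioi, MeasureTheory.integral_const_mul,
    integral_rpow_div_affine hα hd (by positivity), div_rpow (by positivity) hr.le]
  have : r ^ (α - 1) ≠ 0 := (rpow_pos_of_pos hr _).ne'
  field_simp

lemma setIntegral_rpow_div_affine_le {α t d : ℝ} (hα : α ∈ Ioo (0 : ℝ) 1)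
    (hd : 0 < d) (hdt : d ≤ t) :
    ∫ w in Ioi (1 / t), w ^ (α - 1) / (d * w + 1) ≤
      abelConst α * d ^ (-α) - t ^ (-α) / (2 * α) := by
  have ht : 0 < t := hd.trans_le hdt
  have hI := integrableOn_rpow_div_affine hα hd one_pos
  have h0 : (0 : ℝ) ≤ 1 / t := by positivity
  have hsplit : ∫ w in Ioi (0 : ℝ), w ^ (α - 1) / (d * w + 1) =
      (∫ w in Ioc 0 (1 / t), w ^ (α - 1) / (d * w + 1)) +
        ∫ w in Ioi (1 / t), w ^ (α - 1) / (d * w + 1) := by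
    rw [← Ioc_union_Ioi_eq_Ioi h0] at hI ⊢
    exact setIntegral_union Ioc_disjoint_Ioi_same measurableSet_Ioi
      hI.left_of_union hI.right_of_union
  have hpow : IntegrableOn (fun w : ℝ => w ^ (α - 1) / 2) (Ioc 0 (1 / t)) :=
    ((intervalIntegrable_rpow' (by linarith [hα.1])).1).div_const 2
  have hlow : ∫ w in Ioc 0 (1 / t), w ^ (α - 1) / 2 ≤
      ∫ w in Ioc 0 (1 / t), w ^ (α - 1) / (d * w + 1) := by
    refine setIntegral_mono_on hpow (hI.mono_set Ioc_subset_Ioi_self) measurableSet_Ioc ?_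
    intro w hw
    have hdw : d * w ≤ 1 := by
      calc d * w ≤ t * (1 / t) := mul_le_mul hdt hw.2 hw.1.le ht.le
        _ = 1 := by field_simp
    have := mul_pos hd hw.1
    have := rpow_nonneg hw.1.le (α - 1)
    gcongr
    linarith
  have hval : ∫ w in Ioc 0 (1 / t), w ^ (α - 1) / 2 = t ^ (-α) / (2 * α) := by
    rw [← intervalIntegral.integral_of_le h0, intervalIntegral.integral_div,
      integral_rpow (Or.inl (by linarith [hα.1]))]
    simp only [sub_add_cancel, one_div, inv_rpow ht.le, zero_rpow hα.1.ne', sub_zero,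
      rpow_neg ht.le]
    ring
  rw [integral_rpow_div_affine hα hd one_pos, one_rpow, mul_one] at hsplit
  linarith

lemma intervalIntegrable_rpow_sub_mul {α τ a b : ℝ} {g : ℝ → ℝ} (hα : 0 < α)
    (hg : ContinuousOn g (uIcc a b)) :
    IntervalIntegrable (fun s => (τ - s) ^ (α - 1) * g s) volume a b := by
  have h : IntervalIntegrable (fun v : ℝ => v ^ (α - 1)) volume (τ - a) (τ - b) :=
    intervalIntegrable_rpow' (by linarith)
  have := h.comp_sub_left τ
  simp only [sub_sub_cancel] at this
  exact this.mul_continuousOn hg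

lemma setIntegral_abelKernel_mul {α t d w : ℝ} (g : ℝ → ℝ) (ht : 0 < t) (hw : 1 / t < w) :
    ∫ s in Ioc 0 t, abelKernel α (w * (t - s) - 1) / (d * w + 1) * g s =
      w ^ (α - 1) / (d * w + 1) *
        ∫ s in (0 : ℝ)..(t - 1 / w), (t - 1 / w - s) ^ (α - 1) * g s := by
  have hw0 : 0 < w := (one_div_pos.2 ht).trans hw
  have hu : 0 < t - 1 / w := sub_pos.2 ((one_div_lt ht hw0).1 hw)
  have hut : t - 1 / w ≤ t := sub_le_self _ (by positivity)
  have hker (s : ℝ) : w * (t - s) - 1 = w * (t - 1 / w - s) := by field_simp; ring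
  rw [intervalIntegral.integral_of_le hu.le, ← MeasureTheory.integral_const_mul,
    integral_Ioc_eq_integral_Ioo (y := t - 1 / w)]
  refine setIntegral_eq_of_subset_of_forall_sdiff_eq_zero measurableSet_Ioc
    (fun s hs => ⟨hs.1, hs.2.le.trans hut⟩) ?_ |>.trans
      (setIntegral_congr_fun measurableSet_Ioo ?_)
  · intro s hs
    have : t - 1 / w ≤ s := not_lt.1 fun h => hs.2 ⟨hs.1.1, h⟩
    rw [hker, abelKernel_of_nonpos
      (mul_nonpos_of_nonneg_of_nonpos hw0.le (sub_nonpos.2 this)), zero_div, zero_mul]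
  · intro s hs
    have : 0 < t - 1 / w - s := sub_pos.2 hs.2
    simp only [hker, abelKernel_of_pos (mul_pos hw0 this), mul_rpow hw0.le this.le]
    ring

lemma integrable_prod_abelKernel_mul {α t d : ℝ} {g : ℝ → ℝ} (hα : α ∈ Ioo (0 : ℝ) 1)
    (hd : 0 < d) (hg : ContinuousOn g (Icc 0 t)) :
    Integrable (Function.uncurry fun w s =>
        abelKernel α (w * (t - s) - 1) / (d * w + 1) * g s)
      (volume.prod (volume.restrict (Ioo 0 t))) := by
  have hgm : AEStronglyMeasurable g (volume.restrict (Ioo 0 t)) :=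
    (hg.mono Ioo_subset_Icc_self).aestronglyMeasurable measurableSet_Ioo
  have hkm : Measurable fun p : ℝ × ℝ =>
      abelKernel α (p.1 * (t - p.2) - 1) / (d * p.1 + 1) :=
    ((measurable_abelKernel α).comp (by fun_prop)).div (by fun_prop)
  refine (integrable_prod_iff' (hkm.aestronglyMeasurable.mul hgm.comp_snd)).2 ⟨?_, ?_⟩
  · filter_upwards [ae_restrict_mem measurableSet_Ioo] with s hs
    exact (integrable_abelKernel_div hα (sub_pos.2 hs.2) hd).mul_const (g s)
  · have hcont : ContinuousOn
        (fun s => abelConst α * d ^ (-α) * (d + (t - s)) ^ (α - 1) * |g s|) (Icc 0 t) := by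
      refine (ContinuousOn.mul continuousOn_const ?_).mul hg.abs
      refine ContinuousOn.rpow_const (by fun_prop) fun s hs => Or.inl ?_
      linarith [hs.2]
    refine (hcont.integrableOn_Icc.mono_set Ioo_subset_Icc_self).congr ?_
    filter_upwards [ae_restrict_mem measurableSet_Ioo] with s hs
    rw [← integral_abelKernel_div hα (sub_pos.2 hs.2) hd, ← MeasureTheory.integral_mul_const]
    refine integral_congr_ae (Filter.Eventually.of_forall fun w => ?_)
    have hnonneg : 0 ≤ abelKernel α (w * (t - s) - 1) / (d * w + 1) := by
      rcases le_or_gt (w * (t - s) - 1) 0 with h | h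
      · rw [abelKernel_of_nonpos h, zero_div]
      · have : 0 < w := pos_of_mul_pos_left (by linarith) (sub_pos.2 hs.2).le
        exact div_nonneg (abelKernel_nonneg _ _) (by positivity)
    change _ = ‖abelKernel α (w * (t - s) - 1) / (d * w + 1) * g s‖
    rw [norm_mul, norm_eq_abs, norm_eq_abs, abs_of_nonneg hnonneg]

/-- If the Abel integrals of `g` stay above `-m` on `[0, t]`, then the contribution of `[0, t]`
to the Abel integral at the later time `t + d` is bounded below by strictly more than `-m`. -/
lemma neg_mul_le_integral_rpow_add_sub_mul {α t d m : ℝ} {g : ℝ → ℝ}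
    (hα : α ∈ Ioo (0 : ℝ) 1) (hd : 0 < d) (hdt : d ≤ t) (hm : 0 ≤ m)
    (hg : ContinuousOn g (Icc 0 t))
    (hlow : ∀ u ∈ Icc 0 t, -m ≤ ∫ s in (0 : ℝ)..u, (u - s) ^ (α - 1) * g s) :
    -m * (1 - t ^ (-α) / (2 * α * abelConst α) * d ^ α) ≤
      ∫ s in (0 : ℝ)..t, (t + d - s) ^ (α - 1) * g s := by
  have ht : 0 < t := hd.trans_le hdt
  have hC : 0 < abelConst α := integral_rpowIntegrand₀₁_one_pos hα
  have hF := integrable_prod_abelKernel_mul hα hd hg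
  have hswap : ∫ w, ∫ s in Ioo 0 t, abelKernel α (w * (t - s) - 1) / (d * w + 1) * g s =
      abelConst α * d ^ (-α) * ∫ s in (0 : ℝ)..t, (t + d - s) ^ (α - 1) * g s := by
    rw [integral_integral_swap hF, intervalIntegral.integral_of_le ht.le,
      integral_Ioc_eq_integral_Ioo, ← MeasureTheory.integral_const_mul]
    refine setIntegral_congr_fun measurableSet_Ioo fun s hs => ?_
    simp only [MeasureTheory.integral_mul_const, integral_abelKernel_div hα (sub_pos.2 hs.2) hd]
    rw [show d + (t - s) = t + d - s by ring]
    ring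
  have hmass : IntegrableOn (fun w : ℝ => w ^ (α - 1) / (d * w + 1)) (Ioi (1 / t)) :=
    (integrableOn_rpow_div_affine hα hd one_pos).mono_set
      (Ioi_subset_Ioi (one_div_pos.2 ht).le)
  have hmono : ∫ w, (Ioi (1 / t)).indicator (fun w => -m * (w ^ (α - 1) / (d * w + 1))) w ≤
      ∫ w, ∫ s in Ioo 0 t, abelKernel α (w * (t - s) - 1) / (d * w + 1) * g s := by
    refine integral_mono (IntegrableOn.integrable_indicator (hmass.const_mul _) measurableSet_Ioi)
      hF.integral_prod_left fun w => ?_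
    by_cases hw : w ∈ Ioi (1 / t)
    · have hw0 : 0 < w := (one_div_pos.2 ht).trans hw
      have hu := hlow (t - 1 / w)
        ⟨sub_nonneg.2 ((one_div_lt ht hw0).1 hw).le, sub_le_self _ (by positivity)⟩
      rw [indicator_of_mem hw]
      beta_reduce
      rw [← integral_Ioc_eq_integral_Ioo,
        setIntegral_abelKernel_mul g ht hw, mul_comm (-m)]
      exact mul_le_mul_of_nonneg_left hu (by positivity)
    · rw [indicator_of_notMem hw]
      refine (setIntegral_eq_zero_of_forall_eq_zero fun s hs => ?_).ge
      have hwt : w * (t - s) ≤ 1 := by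
        have h1 : w * (t - s) ≤ 1 / t * (t - s) :=
          mul_le_mul_of_nonneg_right (not_lt.1 hw) (sub_pos.2 hs.2).le
        have h2 : 1 / t * (t - s) ≤ 1 / t * t :=
          mul_le_mul_of_nonneg_left (by linarith [hs.1]) (by positivity)
        have h3 : 1 / t * t = 1 := by field_simp
        linarith
      simp only [abelKernel_of_nonpos (sub_nonpos.2 hwt), zero_div, zero_mul]
  rw [hswap, MeasureTheory.integral_indicator measurableSet_Ioi, MeasureTheory.integral_const_mul] at hmono
  have hbound := mul_le_mul_of_nonneg_left (setIntegral_rpow_div_affine_le hα hd hdt) hm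
  have hdα : 0 < d ^ α := rpow_pos_of_pos hd α
  have hα0 := hα.1
  refine le_of_mul_le_mul_left (a := abelConst α * d ^ (-α)) ?_ (by positivity)
  refine le_trans (le_of_eq ?_) ((by linarith : -m * (abelConst α * d ^ (-α) -
    t ^ (-α) / (2 * α)) ≤ _))
  rw [rpow_neg hd.le]
  field_simp

lemma exists_first_zero_of_pos {T c t₀ : ℝ} {y : ℝ → ℝ} (hc : 0 < c)
    (hy : ContinuousOn y (Icc 0 T)) (hy0 : y 0 = c) (ht₀ : t₀ ∈ Icc 0 T) (hyt₀ : y t₀ = 0) :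
    ∃ τ ∈ Ioc 0 T, y τ = 0 ∧ ∀ s ∈ Ico 0 τ, 0 < y s := by
  have hcomp : IsCompact (Icc 0 T ∩ y ⁻¹' {0}) :=
    isCompact_Icc.of_isClosed_subset
      (hy.preimage_isClosed_of_isClosed isClosed_Icc isClosed_singleton) inter_subset_left
  obtain ⟨τ, ⟨hτ, hyτ⟩, hleast⟩ := hcomp.exists_isLeast ⟨t₀, ht₀, hyt₀⟩
  have hyτ' : y τ = 0 := hyτ
  have hτ0 : τ ≠ 0 := by
    rintro rfl
    linarith
  refine ⟨τ, ⟨hτ.1.lt_of_ne' hτ0, hτ.2⟩, hyτ', fun s hs => ?_⟩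
  by_contra! hys
  have hsT : s ≤ T := hs.2.le.trans hτ.2
  obtain ⟨r, hr, hyr⟩ := intermediate_value_Icc' hs.1
    (hy.mono (Icc_subset_Icc_right hsT)) (show (0 : ℝ) ∈ Icc (y s) (y 0) from ⟨hys, by linarith⟩)
  exact absurd (hleast ⟨⟨hr.1, hr.2.trans hsT⟩, hyr⟩) (not_le.2 (hr.2.trans_lt hs.2))

/-- If the Abel integrals of `g` stay above `-m` and `g` vanishes at `τ`, then the Abel integral
at `τ` is strictly larger than `-m`. -/
lemma neg_lt_integral_rpow_sub_mul {α τ m : ℝ} {g : ℝ → ℝ} (hα : α ∈ Ioo (0 : ℝ) 1)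
    (hτ : 0 < τ) (hm : 0 < m) (hg : ContinuousOn g (Icc 0 τ)) (hgτ : g τ = 0)
    (hlow : ∀ u ∈ Ico 0 τ, -m ≤ ∫ s in (0 : ℝ)..u, (u - s) ^ (α - 1) * g s) :
    -m < ∫ s in (0 : ℝ)..τ, (τ - s) ^ (α - 1) * g s := by
  have hα0 := hα.1
  have hC : 0 < abelConst α := integral_rpowIntegrand₀₁_one_pos hα
  set κ := τ ^ (-α) / (2 * α * abelConst α) with hκ
  have hκ0 : 0 < κ := by positivity
  set ε := m * κ * α / 2 with hε
  have hε0 : 0 < ε := by positivity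
  obtain ⟨δ, hδ, hδg⟩ := Metric.continuousWithinAt_iff.1 (hg τ ⟨hτ.le, le_rfl⟩) ε hε0
  obtain ⟨d, hd, hdδ, hdτ⟩ : ∃ d, 0 < d ∧ d < δ ∧ d ≤ τ / 2 :=
    ⟨min (δ / 2) (τ / 2), by positivity, (min_le_left _ _).trans_lt (by linarith),
      min_le_right _ _⟩
  have ht : 0 < τ - d := by linarith
  have hdα : 0 < d ^ α := rpow_pos_of_pos hd α
  have hfar := neg_mul_le_integral_rpow_add_sub_mul hα hd (by linarith : d ≤ τ - d) hm.le
    (hg.mono (Icc_subset_Icc_right (by linarith)))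
    fun u hu => hlow u ⟨hu.1, hu.2.trans_lt (by linarith)⟩
  rw [sub_add_cancel] at hfar
  have hκle : κ ≤ (τ - d) ^ (-α) / (2 * α * abelConst α) :=
    div_le_div_of_nonneg_right
      (rpow_le_rpow_of_nonpos ht (by linarith) (by linarith)) (by positivity)
  have hmκ : m * (κ * d ^ α) ≤ m * ((τ - d) ^ (-α) / (2 * α * abelConst α) * d ^ α) := by
    gcongr
  have hnear : -ε * (d ^ α / α) ≤ ∫ s in (τ - d)..τ, (τ - s) ^ (α - 1) * g s := by
    have hval : ∫ s in (τ - d)..τ, (τ - s) ^ (α - 1) * (-ε) = -ε * (d ^ α / α) := by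
      rw [intervalIntegral.integral_mul_const,
        intervalIntegral.integral_comp_sub_left (fun v : ℝ => v ^ (α - 1)) τ, sub_self,
        sub_sub_cancel, integral_rpow (Or.inl (by linarith)), sub_add_cancel,
        zero_rpow hα0.ne', sub_zero, mul_comm]
    rw [← hval]
    refine intervalIntegral.integral_mono_on (by linarith)
      (intervalIntegrable_rpow_sub_mul hα0 continuousOn_const)
      (intervalIntegrable_rpow_sub_mul hα0 (hg.mono ?_)) fun s hs => ?_
    · rw [uIcc_of_le (by linarith)]
      exact Icc_subset_Icc_left ht.le
    · have := hδg (show s ∈ Icc 0 τ from ⟨ht.le.trans hs.1, hs.2⟩)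
        (by rw [dist_eq, abs_lt]; constructor <;> linarith [hs.1, hs.2])
      rw [hgτ, dist_zero_right, norm_eq_abs] at this
      exact mul_le_mul_of_nonneg_left (abs_lt.1 this).1.le
        (rpow_nonneg (sub_nonneg.2 hs.2) _)
  have hadd : (∫ s in (0 : ℝ)..(τ - d), (τ - s) ^ (α - 1) * g s) +
      ∫ s in (τ - d)..τ, (τ - s) ^ (α - 1) * g s =
        ∫ s in (0 : ℝ)..τ, (τ - s) ^ (α - 1) * g s := by
    apply intervalIntegral.integral_add_adjacent_intervals <;>
      refine intervalIntegrable_rpow_sub_mul hα0 (hg.mono ?_)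
    · rw [uIcc_of_le ht.le]
      exact Icc_subset_Icc_right (by linarith)
    · rw [uIcc_of_le (by linarith)]
      exact Icc_subset_Icc_left ht.le
  have hεd : ε * (d ^ α / α) = m * κ * d ^ α / 2 := by
    rw [hε]
    field_simp
  have : 0 < m * κ * d ^ α := by positivity
  linarith

/-- A nonnegative function whose increments satisfy a linear bound does not reach zero in finite
time. -/
lemma ne_zero_of_integral_of_abs_le_mul {τ c M : ℝ} {g y : ℝ → ℝ} (hτ : 0 < τ)
    (hy : ContinuousOn y (Icc 0 τ)) (hg : ContinuousOn g (Icc 0 τ))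
    (hgy : ∀ s ∈ Icc 0 τ, |g s| ≤ M * |y s|) (hpos : ∀ s ∈ Ico 0 τ, 0 < y s)
    (hsol : ∀ t ∈ Icc 0 τ, y t = c + ∫ s in (0 : ℝ)..t, g s) : y τ ≠ 0 := by
  intro hyτ
  obtain ⟨d, hd, hdM, hdτ⟩ : ∃ d, 0 < d ∧ |M| * d < 1 ∧ d ≤ τ := by
    refine ⟨min (1 / (|M| + 1)) τ, by positivity, ?_, min_le_right _ _⟩
    calc |M| * min (1 / (|M| + 1)) τ ≤ |M| * (1 / (|M| + 1)) := by gcongr; exact min_le_left _ _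
      _ < 1 := by rw [mul_one_div, div_lt_one (by positivity)]; linarith
  have hsub : Icc (τ - d) τ ⊆ Icc 0 τ := Icc_subset_Icc_left (by linarith)
  obtain ⟨p, hp, hmax⟩ := isCompact_Icc.exists_isMaxOn
    (nonempty_Icc.2 (by linarith : τ - d ≤ τ)) (hy.mono hsub)
  have hyp : 0 < y p :=
    (hpos (τ - d) ⟨by linarith, by linarith⟩).trans_le (hmax (left_mem_Icc.2 (by linarith)))
  have hp0 := hsub hp
  have hint (a b : ℝ) (ha : a ∈ Icc 0 τ) (hb : b ∈ Icc 0 τ) : IntervalIntegrable g volume a b :=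
    (hg.mono (uIcc_subset_Icc ha hb)).intervalIntegrable
  have h0 : (0 : ℝ) ∈ Icc 0 τ := ⟨le_rfl, hτ.le⟩
  have hτ' : τ ∈ Icc 0 τ := ⟨hτ.le, le_rfl⟩
  have hdiff : y p = -∫ s in p..τ, g s := by
    have h1 := hsol p hp0
    have h2 := hsol τ hτ'
    rw [← intervalIntegral.integral_add_adjacent_intervals (hint 0 p h0 hp0)
      (hint p τ hp0 hτ')] at h2
    linarith
  have hbound : ‖∫ s in p..τ, g s‖ ≤ |M| * y p * |τ - p| := by
    refine intervalIntegral.norm_integral_le_of_norm_le_const fun s hs => ?_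
    rw [uIoc_of_le hp.2] at hs
    have hs0 : s ∈ Icc 0 τ := ⟨hp0.1.trans hs.1.le, hs.2⟩
    have hys : 0 ≤ y s := by
      rcases hs.2.lt_or_eq with h | rfl
      · exact (hpos s ⟨hs0.1, h⟩).le
      · exact hyτ.ge
    calc ‖g s‖ ≤ M * |y s| := hgy s hs0
      _ ≤ |M| * y p := by
        rw [abs_of_nonneg hys]
        exact mul_le_mul (le_abs_self M) (hmax ⟨hp.1.trans hs.1.le, hs.2⟩) hys (abs_nonneg M)
  rw [norm_eq_abs, abs_of_nonneg (sub_nonneg.2 hp.2)] at hbound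
  have h1 : |M| * y p * (τ - p) ≤ |M| * y p * d := by
    gcongr
    linarith [hp.1]
  have h2 : |M| * d * y p < 1 * y p := mul_lt_mul_of_pos_right hdM hyp
  have h3 := neg_le_abs (∫ s in p..τ, g s)
  linarith

/-- A solution of a linearly bounded Abel–Volterra equation with positive initial value has no
zeros. -/
lemma abelVolterra_ne_zero {α T c M : ℝ} {g y : ℝ → ℝ} (hα : 0 < α) (hα1 : α ≤ 1) (hc : 0 < c)
    (hy : ContinuousOn y (Icc 0 T)) (hg : ContinuousOn g (Icc 0 T))
    (hgy : ∀ s ∈ Icc 0 T, |g s| ≤ M * |y s|)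
    (hsol : ∀ t ∈ Icc 0 T,
      y t = c + (1 / Gamma α) * ∫ s in (0 : ℝ)..t, (t - s) ^ (α - 1) * g s) :
    ∀ t ∈ Icc 0 T, y t ≠ 0 := by
  intro t₀ ht₀ hyt₀
  have hy0 : y 0 = c := by simpa using hsol 0 ⟨le_rfl, ht₀.1.trans ht₀.2⟩
  obtain ⟨τ, ⟨hτ, hτT⟩, hyτ, hpos⟩ := exists_first_zero_of_pos hc hy hy0 ht₀ hyt₀
  have hsub : Icc 0 τ ⊆ Icc 0 T := Icc_subset_Icc_right hτT
  have hτ' : τ ∈ Icc 0 τ := ⟨hτ.le, le_rfl⟩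
  rcases hα1.lt_or_eq with hα1 | rfl
  · have hΓ : 0 < Gamma α := Gamma_pos_of_pos hα
    have hgτ : g τ = 0 := by simpa [hyτ] using hgy τ (hsub hτ')
    have hint (t : ℝ) (ht : t ∈ Icc 0 T) :
        ∫ s in (0 : ℝ)..t, (t - s) ^ (α - 1) * g s = Gamma α * (y t - c) := by
      rw [hsol t ht]
      field_simp
      ring
    have hlt := neg_lt_integral_rpow_sub_mul ⟨hα, hα1⟩ hτ (mul_pos hΓ hc) (hg.mono hsub) hgτ
      fun u hu => by
        rw [hint u (hsub ⟨hu.1, hu.2.le⟩)]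
        linarith [mul_pos hΓ (hpos u hu)]
    rw [hint τ (hsub hτ'), hyτ] at hlt
    linarith
  · refine ne_zero_of_integral_of_abs_le_mul (c := c) hτ (hy.mono hsub) (hg.mono hsub)
      (fun s hs => hgy s (hsub hs)) hpos (fun t ht => ?_) hyτ
    simpa using hsol t (hsub ht)

end AbelKernel

/-- Trajectories of two solutions with distinct initial values never meet on `[0,T]`. -/
theorem caputo_trajectories_separate (α T : ℝ) (hα : 0 < α) (hα1 : α ≤ 1) (hT : 0 < T)
    (f : ℝ → ℝ → ℝ)
    (hf : ContinuousOn (fun p : ℝ × ℝ => f p.1 p.2) (Set.Icc 0 T ×ˢ Set.univ))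
    (L : ℝ → ℝ) (hLc : ContinuousOn L (Set.Icc 0 T))
    (hLnn : ∀ t ∈ Set.Icc 0 T, 0 ≤ L t)
    (hLip : ∀ t ∈ Set.Icc 0 T, ∀ x y : ℝ, |f t x - f t y| ≤ L t * |x - y|)
    (x₁₀ x₂₀ : ℝ) (hne : x₁₀ ≠ x₂₀) (x₁ x₂ : ℝ → ℝ)
    (hx₁ : IsCaputoSolution α T f x₁₀ x₁) (hx₂ : IsCaputoSolution α T f x₂₀ x₂) :
    ∀ t ∈ Set.Icc 0 T, x₁ t ≠ x₂ t := by
  have hcont {x : ℝ → ℝ} (hx : ContinuousOn x (Icc 0 T)) :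
      ContinuousOn (fun s => f s (x s)) (Icc 0 T) :=
    hf.comp (continuousOn_id.prodMk hx) fun s hs => ⟨hs, mem_univ _⟩
  obtain ⟨M, hM⟩ := isCompact_Icc.bddAbove_image hLc
  have main : ∀ {a b : ℝ} {x z : ℝ → ℝ}, b < a → IsCaputoSolution α T f a x →
      IsCaputoSolution α T f b z → ∀ t ∈ Icc 0 T, x t ≠ z t := by
    intro a b x z hab hx hz t ht hxz
    refine abelVolterra_ne_zero (M := M) (y := fun s => x s - z s)
      (g := fun s => f s (x s) - f s (z s)) hα hα1 (sub_pos.2 hab) (hx.1.sub hz.1)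
      ((hcont hx.1).sub (hcont hz.1)) (fun s hs => ?_) (fun u hu => ?_) t ht (sub_eq_zero.2 hxz)
    · exact (hLip s hs _ _).trans
        (mul_le_mul_of_nonneg_right (hM (mem_image_of_mem L hs)) (abs_nonneg _))
    · have hsub : uIcc 0 u ⊆ Icc 0 T := uIcc_subset_Icc ⟨le_rfl, hT.le⟩ hu
      simp only [mul_sub]
      rw [hx.2 u hu, hz.2 u hu, intervalIntegral.integral_sub
        (intervalIntegrable_rpow_sub_mul hα ((hcont hx.1).mono hsub))
        (intervalIntegrable_rpow_sub_mul hα ((hcont hz.1).mono hsub))]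
      ring
  intro t ht h
  rcases hne.lt_or_gt with hlt | hlt
  · exact main hlt hx₂ hx₁ t ht h.symm
  · exact main hlt hx₁ hx₂ t ht h
end

section
/- Let α ∈ (0,1], T > 0, and let f : [0,T] × ℝ → ℝ be continuous and satisfy the Lipschitz condition. Let x₁ and x₂ be solutions on [0,T] of the Caputo fractional initial value problems with the same f and initial values x₁(0) = x₁₀ and x₂(0) = x₂₀. If x₁₀ < x₂₀, then x₁(t) < x₂(t) for all t ∈ [0,T]. -/
open Set intervalIntegral

open MeasureTheory Filter Topology

/-- The contribution of the source `g` on `[0, u]` to the (unnormalised) Riemann–Liouville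
integral of order `α` at time `t`. -/
noncomputable def truncatedIntegral (α : ℝ) (g : ℝ → ℝ) (t u : ℝ) : ℝ :=
  ∫ s in (0:ℝ)..u, (t - s) ^ (α - 1) * g s

section

variable {α : ℝ} {g : ℝ → ℝ}

lemma intervalIntegrable_sub_rpow (hα : 0 < α) (t a b : ℝ) :
    IntervalIntegrable (fun s : ℝ => (t - s) ^ (α - 1)) volume a b := by
  have h : IntervalIntegrable (fun s : ℝ => s ^ (α - 1)) volume (t - a) (t - b) :=
    intervalIntegrable_rpow' (by linarith)
  simpa using h.comp_sub_left t

lemma intervalIntegrable_sub_rpow_mul (hα : 0 < α) (hg : Continuous g) (t a b : ℝ) :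
    IntervalIntegrable (fun s : ℝ => (t - s) ^ (α - 1) * g s) volume a b :=
  (intervalIntegrable_sub_rpow hα t a b).mul_continuousOn hg.continuousOn

lemma truncatedIntegral_add (hα : 0 < α) (hg : Continuous g) (t u : ℝ) :
    truncatedIntegral α g t t =
      truncatedIntegral α g t u + ∫ s in u..t, (t - s) ^ (α - 1) * g s :=
  (integral_add_adjacent_intervals (intervalIntegrable_sub_rpow_mul hα hg t 0 u)
    (intervalIntegrable_sub_rpow_mul hα hg t u t)).symm

lemma hasDerivAt_truncatedIntegral (hα : 0 < α) (hg : Continuous g) {t u : ℝ} (hut : u < t) :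
    HasDerivAt (truncatedIntegral α g t) ((t - u) ^ (α - 1) * g u) u := by
  have hc : ContinuousOn (fun s : ℝ => (t - s) ^ (α - 1) * g s) (Iio t) := by
    refine ContinuousOn.mul (ContinuousOn.rpow_const (by fun_prop) ?_) hg.continuousOn
    intro s hs
    left
    have : s < t := hs
    linarith
  exact integral_hasDerivAt_right (intervalIntegrable_sub_rpow_mul hα hg t 0 u)
    (hc.stronglyMeasurableAtFilter isOpen_Iio u hut) (hc.continuousAt (Iio_mem_nhds hut))

lemma continuous_truncatedIntegral (hα : 0 < α) (hg : Continuous g) {C : ℝ}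
    (hC : ∀ s, |g s| ≤ C) :
    Continuous (fun p : ℝ × ℝ => truncatedIntegral α g p.1 p.2) := by
  have hH : Continuous (fun p : ℝ × ℝ => ∫ r in (0:ℝ)..p.2, r ^ (α - 1) * g (p.1 - r)) := by
    rw [continuous_iff_continuousAt]
    rintro ⟨t, b⟩
    refine continuousAt_parametric_primitive_of_dominated (μ := volume)
      (F := fun t r => r ^ (α - 1) * g (t - r))
      (fun r => |r ^ (α - 1)| * C) (-|b| - 1) (|b| + 1) ?_ ?_ ?_ ?_ ?_ ?_ (by simp)
    · intro x
      have : Measurable fun r : ℝ => r ^ (α - 1) * g (x - r) := by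
        have := hg.measurable
        fun_prop
      exact this.aestronglyMeasurable
    · refine Eventually.of_forall fun x => Eventually.of_forall fun r => ?_
      rw [norm_mul, Real.norm_eq_abs, Real.norm_eq_abs]
      exact mul_le_mul_of_nonneg_left (hC _) (abs_nonneg _)
    · exact (intervalIntegrable_rpow' (by linarith)).abs.mul_const C
    · refine Eventually.of_forall fun r => ?_
      fun_prop
    · constructor <;> linarith [abs_nonneg b]
    · constructor <;> linarith [abs_nonneg b, neg_abs_le b, le_abs_self b]
  have hI : ∀ t a b : ℝ,
      IntervalIntegrable (fun r : ℝ => r ^ (α - 1) * g (t - r)) volume a b := fun t a b =>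
    (intervalIntegrable_rpow' (by linarith)).mul_continuousOn (by fun_prop)
  have hEq : (fun p : ℝ × ℝ => truncatedIntegral α g p.1 p.2) = fun p : ℝ × ℝ =>
      (∫ r in (0:ℝ)..p.1, r ^ (α - 1) * g (p.1 - r)) -
        ∫ r in (0:ℝ)..(p.1 - p.2), r ^ (α - 1) * g (p.1 - r) := by
    ext ⟨t, u⟩
    have := integral_comp_sub_left (a := 0) (b := u) (fun r => r ^ (α - 1) * g (t - r)) t
    simp only [sub_sub_cancel, sub_zero] at this
    rw [truncatedIntegral, this, integral_interval_sub_left (hI _ _ _) (hI _ _ _)]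
  rw [hEq]
  exact (hH.comp (continuous_fst.prodMk continuous_fst)).sub
    (hH.comp (continuous_fst.prodMk (continuous_fst.sub continuous_snd)))

/-- A comparison between two evaluation times, from the monotonicity of the ratio of kernels. -/
lemma le_truncatedIntegral (hα : 0 < α) (hα1 : α ≤ 1) (hg : Continuous g) {u v t m : ℝ}
    (hu : 0 ≤ u) (huv : u < v) (hvt : v ≤ t)
    (hm : ∀ w ∈ Icc 0 u, m ≤ truncatedIntegral α g v w) :
    ((v - u) / (t - u)) ^ (1 - α) * (truncatedIntegral α g v u - m) + (v / t) ^ (1 - α) * m ≤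
      truncatedIntegral α g t u := by
  set D : ℝ → ℝ := fun w => truncatedIntegral α g t w -
    ((v - w) / (t - w)) ^ (1 - α) * (truncatedIntegral α g v w - m)
  have hD : ∀ w ∈ Icc 0 u, HasDerivAt D
      ((t - v) / (t - w) ^ 2 * (1 - α) * ((v - w) / (t - w)) ^ (1 - α - 1) *
        (truncatedIntegral α g v w - m)) w := by
    intro w hw
    have hvw : 0 < v - w := by linarith [hw.2]
    have htw : 0 < t - w := by linarith
    have hb : HasDerivAt (fun w => (v - w) / (t - w)) (-((t - v) / (t - w) ^ 2)) w := by
      refine (((hasDerivAt_id w).const_sub v).div ((hasDerivAt_id w).const_sub t)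
        htw.ne').congr_deriv ?_
      simp only [id]
      ring
    have hρ := hb.rpow_const (p := 1 - α) (Or.inl (div_pos hvw htw).ne')
    have hF := hasDerivAt_truncatedIntegral hα hg (sub_pos.mp hvw)
    have hG := hasDerivAt_truncatedIntegral hα hg (sub_pos.mp htw)
    have hk : (t - w) ^ (α - 1) = ((v - w) / (t - w)) ^ (1 - α) * (v - w) ^ (α - 1) := by
      rw [Real.div_rpow hvw.le htw.le, show α - 1 = -(1 - α) by ring, Real.rpow_neg hvw.le,
        Real.rpow_neg htw.le]
      have := (Real.rpow_pos_of_pos hvw (1 - α)).ne'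
      field_simp
    refine (hG.sub (hρ.mul (hF.sub_const m))).congr_deriv ?_
    rw [hk]
    ring
  have hmono : MonotoneOn D (Icc 0 u) := by
    refine monotoneOn_of_deriv_nonneg (convex_Icc 0 u)
      (fun w hw => (hD w hw).continuousAt.continuousWithinAt)
      (fun w hw => (hD w (interior_subset hw)).differentiableAt.differentiableWithinAt)
      fun w hw => ?_
    have hw' := interior_subset hw
    rw [(hD w hw').deriv]
    have hvw : 0 < v - w := by linarith [hw'.2]
    have htw : 0 < t - w := by linarith
    have := sub_nonneg.mpr (hm w hw')
    have : 0 ≤ t - v := by linarith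
    have : 0 ≤ 1 - α := by linarith
    positivity
  have h := hmono (left_mem_Icc.mpr hu) (right_mem_Icc.mpr hu) hu
  simp only [D, sub_zero, truncatedIntegral, integral_same] at h
  simp only [truncatedIntegral]
  linarith

/-- If the full integrals are at least `-c`, then so are the truncated ones. -/
lemma neg_le_truncatedIntegral (hα : 0 < α) (hα1 : α ≤ 1) (hg : Continuous g) {C : ℝ}
    (hC : ∀ s, |g s| ≤ C) {T c : ℝ} (hc : 0 ≤ c)
    (hdiag : ∀ t ∈ Icc 0 T, -c ≤ truncatedIntegral α g t t) {t u : ℝ} (hu : 0 ≤ u) (hut : u ≤ t)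
    (htT : t ≤ T) : -c ≤ truncatedIntegral α g t u := by
  rcases hα1.eq_or_lt with rfl | hα1
  · simpa [truncatedIntegral] using hdiag u ⟨hu, hut.trans htT⟩
  set K : Set (ℝ × ℝ) := (Icc 0 T ×ˢ Icc 0 T) ∩ {p | p.2 ≤ p.1}
  have hK : IsCompact K := (isCompact_Icc.prod isCompact_Icc).inter_right
    (isClosed_le continuous_snd continuous_fst)
  have htu : (t, u) ∈ K := ⟨⟨⟨hu.trans hut, htT⟩, ⟨hu, hut.trans htT⟩⟩, hut⟩
  obtain ⟨⟨t₀, u₀⟩, hp, hmin⟩ := hK.exists_isMinOn ⟨_, htu⟩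
    (continuous_truncatedIntegral hα hg hC).continuousOn
  refine le_trans ?_ (isMinOn_iff.mp hmin _ htu)
  obtain ⟨⟨ht₀, hu₀⟩, hle⟩ := hp
  simp only [mem_ofPred_eq] at ht₀ hu₀ hle ⊢
  by_contra! hlt
  have hlt' : u₀ < t₀ := by
    refine lt_of_le_of_ne hle fun h => ?_
    subst h
    linarith [hdiag _ hu₀]
  obtain ⟨v, huv, hvt⟩ := exists_between hlt'
  have hv : 0 < v := hu₀.1.trans_lt huv
  set m := truncatedIntegral α g t₀ u₀
  have hm : ∀ w ∈ Icc 0 u₀, m ≤ truncatedIntegral α g v w := fun w hw =>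
    isMinOn_iff.mp hmin (v, w) ⟨⟨⟨hv.le, hvt.le.trans ht₀.2⟩, ⟨hw.1, hw.2.trans hu₀.2⟩⟩,
      hw.2.trans huv.le⟩
  have h := le_truncatedIntegral hα hα1.le hg hu₀.1 huv hvt.le hm
  have h1 : 0 ≤ ((v - u₀) / (t₀ - u₀)) ^ (1 - α) * (truncatedIntegral α g v u₀ - m) :=
    mul_nonneg (Real.rpow_nonneg (div_nonneg (by linarith) (by linarith)) _)
      (sub_nonneg.mpr (hm u₀ ⟨hu₀.1, le_rfl⟩))
  have h2 : (v / t₀) ^ (1 - α) < 1 :=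
    Real.rpow_lt_one (div_nonneg hv.le (hv.trans hvt).le) ((div_lt_one (hv.trans hvt)).mpr hvt)
      (by linarith)
  have hm0 : m < 0 := by linarith
  nlinarith

/-- The truncated solution, weighted by the inverse kernel, is monotone in time. -/
lemma rpow_mul_add_truncatedIntegral_le (hα : 0 < α) (hα1 : α ≤ 1) (hg : Continuous g) {C : ℝ}
    (hC : ∀ s, |g s| ≤ C) {T c : ℝ} (hc : 0 ≤ c)
    (hdiag : ∀ t ∈ Icc 0 T, -c ≤ truncatedIntegral α g t t) {u v t : ℝ} (hu : 0 ≤ u) (huv : u < v)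
    (hvt : v ≤ t) (htT : t ≤ T) :
    (v - u) ^ (1 - α) * (c + truncatedIntegral α g v u) ≤
      (t - u) ^ (1 - α) * (c + truncatedIntegral α g t u) := by
  have h := le_truncatedIntegral hα hα1 hg hu huv hvt (m := -c) fun w hw =>
    neg_le_truncatedIntegral hα hα1 hg hC hc hdiag hw.1 (hw.2.trans huv.le) (hvt.trans htT)
  have hv : 0 < v := hu.trans_lt huv
  have h1 : (v / t) ^ (1 - α) ≤ 1 :=
    Real.rpow_le_one (div_nonneg hv.le (hv.trans_le hvt).le)
      ((div_le_one (hv.trans_le hvt)).mpr hvt) (by linarith)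
  have htu : 0 < t - u := by linarith
  have hpos := Real.rpow_pos_of_pos htu (1 - α)
  rw [Real.div_rpow (by linarith) htu.le] at h
  have h2 : (v - u) ^ (1 - α) / (t - u) ^ (1 - α) * (c + truncatedIntegral α g v u) ≤
      c + truncatedIntegral α g t u := by
    nlinarith
  rw [div_mul_eq_mul_div, div_le_iff₀ hpos] at h2
  linarith

/-- An upper bound for the convolution of the kernel with a source dominated by the kernel. -/
lemma rpow_mul_abs_integral_le (hα : 0 < α) (hα1 : α ≤ 1) {u t A : ℝ} (hut : u < t) (hA : 0 ≤ A)
    (h : ∀ s ∈ Ioo u t, |g s| ≤ A * (s - u) ^ (α - 1)) :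
    (t - u) ^ (1 - α) * |∫ s in u..t, (t - s) ^ (α - 1) * g s| ≤
      4 * A * (t - u) ^ α / α := by
  have hd : 0 < t - u := sub_pos.mpr hut
  set B : ℝ := ((t - u) / 2) ^ (α - 1)
  have hB : 0 ≤ B := Real.rpow_nonneg (by linarith) _
  have hI1 := intervalIntegrable_sub_rpow hα t u t
  have hI2 : IntervalIntegrable (fun s : ℝ => (s - u) ^ (α - 1)) volume u t := by
    have h : IntervalIntegrable (fun s : ℝ => s ^ (α - 1)) volume 0 (t - u) :=
      intervalIntegrable_rpow' (by linarith)
    simpa using h.comp_sub_right u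
  have hbound : ∀ s ∈ Ioo u t, |(t - s) ^ (α - 1) * g s| ≤
      A * B * ((t - s) ^ (α - 1) + (s - u) ^ (α - 1)) := by
    intro s hs
    have hts : 0 < t - s := sub_pos.mpr hs.2
    have hsu : 0 < s - u := sub_pos.mpr hs.1
    have p1 := Real.rpow_nonneg hts.le (α - 1)
    have p2 := Real.rpow_nonneg hsu.le (α - 1)
    rw [abs_mul, abs_of_nonneg p1]
    have key : (t - s) ^ (α - 1) * (s - u) ^ (α - 1) ≤
        B * ((t - s) ^ (α - 1) + (s - u) ^ (α - 1)) := by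
      rcases le_total (s - u) (t - s) with hle | hle
      · have : (t - s) ^ (α - 1) ≤ B :=
          Real.rpow_le_rpow_of_nonpos (by linarith) (by linarith) (by linarith)
        nlinarith
      · have : (s - u) ^ (α - 1) ≤ B :=
          Real.rpow_le_rpow_of_nonpos (by linarith) (by linarith) (by linarith)
        nlinarith
    calc (t - s) ^ (α - 1) * |g s| ≤ (t - s) ^ (α - 1) * (A * (s - u) ^ (α - 1)) :=
          mul_le_mul_of_nonneg_left (h s hs) p1
      _ = A * ((t - s) ^ (α - 1) * (s - u) ^ (α - 1)) := by ring
      _ ≤ A * (B * ((t - s) ^ (α - 1) + (s - u) ^ (α - 1))) :=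
          mul_le_mul_of_nonneg_left key hA
      _ = _ := by ring
  have hae : ∀ᵐ s : ℝ, s ∈ Ioc u t → ‖(t - s) ^ (α - 1) * g s‖ ≤
      A * B * ((t - s) ^ (α - 1) + (s - u) ^ (α - 1)) := by
    filter_upwards [Measure.ae_ne volume t] with s hs hs'
    exact hbound s ⟨hs'.1, lt_of_le_of_ne hs'.2 hs⟩
  have hle := norm_integral_le_of_norm_le hut.le hae ((hI1.add hI2).const_mul (A * B))
  have e1 : ∫ s in u..t, (t - s) ^ (α - 1) = (t - u) ^ α / α := by
    rw [integral_comp_sub_left (fun r : ℝ => r ^ (α - 1)) t,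
      integral_rpow (Or.inl (by linarith))]
    simp [Real.zero_rpow hα.ne']
  have e2 : ∫ s in u..t, (s - u) ^ (α - 1) = (t - u) ^ α / α := by
    rw [integral_comp_sub_right (fun r : ℝ => r ^ (α - 1)) u,
      integral_rpow (Or.inl (by linarith))]
    simp [Real.zero_rpow hα.ne']
  rw [intervalIntegral.integral_const_mul, intervalIntegral.integral_add hI1 hI2,
    e1, e2, Real.norm_eq_abs] at hle
  have hB2 : (t - u) ^ (1 - α) * B ≤ 2 := by
    rw [show B = (t - u) ^ (α - 1) / 2 ^ (α - 1) from Real.div_rpow hd.le (by norm_num) _,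
      mul_div_assoc', ← Real.rpow_add hd, show 1 - α + (α - 1) = 0 by ring, Real.rpow_zero,
      one_div, ← Real.rpow_neg (by norm_num)]
    calc (2:ℝ) ^ (-(α - 1)) ≤ 2 ^ (1:ℝ) :=
          Real.rpow_le_rpow_of_exponent_le (by norm_num) (by linarith)
      _ = 2 := Real.rpow_one 2
  have hpos := Real.rpow_nonneg hd.le (1 - α)
  have hX : 0 ≤ A * ((t - u) ^ α / α) :=
    mul_nonneg hA (div_nonneg (Real.rpow_nonneg hd.le _) hα.le)
  calc (t - u) ^ (1 - α) * |∫ s in u..t, (t - s) ^ (α - 1) * g s|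
      ≤ (t - u) ^ (1 - α) * (A * B * ((t - u) ^ α / α + (t - u) ^ α / α)) :=
        mul_le_mul_of_nonneg_left hle hpos
    _ = (t - u) ^ (1 - α) * B * (2 * (A * ((t - u) ^ α / α))) := by ring
    _ ≤ 2 * (2 * (A * ((t - u) ^ α / α))) := mul_le_mul_of_nonneg_right hB2 (by linarith)
    _ = 4 * A * (t - u) ^ α / α := by ring

/-- A solution of a linearly bounded Volterra equation with a positive initial value cannot reach
zero. -/
lemma pos_of_eq_add_truncatedIntegral (hα : 0 < α) (hα1 : α ≤ 1) (hg : Continuous g) {C : ℝ}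
    (hC : ∀ s, |g s| ≤ C) {T c M : ℝ} (hT : 0 < T) (hc : 0 ≤ c) (hM : 0 ≤ M) {z : ℝ → ℝ}
    (hz : ContinuousOn z (Icc 0 T))
    (heq : ∀ t ∈ Icc 0 T, z t = c + truncatedIntegral α g t t)
    (hpos : ∀ t ∈ Ico 0 T, 0 < z t) (hgz : ∀ t ∈ Ico 0 T, |g t| ≤ M * z t) : 0 < z T := by
  have hnn : ∀ t ∈ Icc 0 T, 0 ≤ z t := by
    have hcl : closure (Ico 0 T) = Icc 0 T := closure_Ico hT.ne
    intro t ht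
    exact le_on_closure (f := fun _ => 0) (fun x hx => (hpos x hx).le) continuousOn_const
      (hcl ▸ hz) (hcl ▸ ht)
  have hdiag : ∀ t ∈ Icc 0 T, -c ≤ truncatedIntegral α g t t := fun t ht => by
    linarith [hnn t ht, heq t ht]
  obtain ⟨u, hu, huT, hsmall⟩ : ∃ u, 0 ≤ u ∧ u < T ∧ 4 * M * (T - u) ^ α / α ≤ 1 / 4 := by
    have hcont : Continuous fun u : ℝ => 4 * M * (T - u) ^ α / α :=
      ((continuous_const.mul ((continuous_const.sub continuous_id).rpow_const
        fun _ => Or.inr hα.le)).div_const _)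
    have hlim : ∀ᶠ u in 𝓝[<] T, 4 * M * (T - u) ^ α / α < 1 / 4 :=
      (hcont.tendsto T).mono_left nhdsWithin_le_nhds |>.eventually
        (gt_mem_nhds (by simp [Real.zero_rpow hα.ne']))
    obtain ⟨u, h1, h2⟩ := (hlim.and (Ico_mem_nhdsLT hT)).exists
    exact ⟨u, h2.1, h2.2, h1.le⟩
  have huT' : 0 < T - u := sub_pos.mpr huT
  set q : ℝ → ℝ := fun t => c + truncatedIntegral α g t u
  set Q : ℝ := (T - u) ^ (1 - α) * q T
  have hqQ : ∀ t ∈ Ioc u T, (t - u) ^ (1 - α) * q t ≤ Q := fun t ht =>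
    rpow_mul_add_truncatedIntegral_le hα hα1 hg hC hc hdiag hu ht.1 ht.2 le_rfl
  have hQ : 0 < Q := by
    have hqc : Continuous q := continuous_const.add
      ((continuous_truncatedIntegral hα hg hC).comp (continuous_id.prodMk continuous_const))
    have hqu : 0 < q u := by
      simpa only [q, ← heq u ⟨hu, huT.le⟩] using hpos u ⟨hu, huT⟩
    have hev : ∀ᶠ v in 𝓝[>] u, 0 < q v :=
      ((hqc.tendsto u).mono_left nhdsWithin_le_nhds).eventually (lt_mem_nhds hqu)
    obtain ⟨v, h1, h2⟩ := (hev.and (Ioc_mem_nhdsGT huT)).exists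
    exact (mul_pos (Real.rpow_pos_of_pos (sub_pos.mpr h2.1) _) h1).trans_le (hqQ v h2)
  set W : ℝ → ℝ := fun t => (t - u) ^ (1 - α) * z t
  have hW : ContinuousOn W (Icc u T) := by
    refine ContinuousOn.mul (ContinuousOn.rpow_const (by fun_prop) ?_)
      (hz.mono (Icc_subset_Icc_left hu))
    exact fun _ _ => Or.inr (by linarith)
  obtain ⟨τ, hτ, hmax⟩ := isCompact_Icc.exists_isMaxOn (nonempty_Icc.mpr huT.le) hW
  have hZ : ∀ t ∈ Icc u T, W t ≤ W τ := fun t ht => isMaxOn_iff.mp hmax t ht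
  have hZ0 : 0 ≤ W τ := mul_nonneg (Real.rpow_nonneg (by linarith [hτ.1]) _)
    (hnn τ ⟨hu.trans hτ.1, hτ.2⟩)
  have hest : ∀ t ∈ Ioc u T, |W t - (t - u) ^ (1 - α) * q t| ≤ W τ / 4 := by
    intro t ht
    have htu : 0 < t - u := sub_pos.mpr ht.1
    have hsrc : ∀ s ∈ Ioo u t, |g s| ≤ M * W τ * (s - u) ^ (α - 1) := by
      intro s hs
      have hsu : 0 < s - u := sub_pos.mpr hs.1
      have hzs : z s = W s * (s - u) ^ (α - 1) := by
        simp only [W]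
        rw [mul_right_comm, ← Real.rpow_add hsu]
        simp
      calc |g s| ≤ M * z s := hgz s ⟨hu.trans hs.1.le, hs.2.trans_le ht.2⟩
        _ = M * (W s * (s - u) ^ (α - 1)) := by rw [hzs]
        _ ≤ M * (W τ * (s - u) ^ (α - 1)) := by
            gcongr
            exact hZ s ⟨hs.1.le, hs.2.le.trans ht.2⟩
        _ = _ := by ring
    have h := rpow_mul_abs_integral_le hα hα1 ht.1 (mul_nonneg hM hZ0) hsrc
    have hdiff : W t - (t - u) ^ (1 - α) * q t =
        (t - u) ^ (1 - α) * ∫ s in u..t, (t - s) ^ (α - 1) * g s := by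
      simp only [W, q]
      rw [heq t ⟨hu.trans ht.1.le, ht.2⟩, truncatedIntegral_add hα hg t u]
      ring
    rw [hdiff, abs_mul, abs_of_nonneg (Real.rpow_nonneg htu.le _)]
    refine h.trans ?_
    calc 4 * (M * W τ) * (t - u) ^ α / α = W τ * (4 * M * (t - u) ^ α / α) := by ring
      _ ≤ W τ * (4 * M * (T - u) ^ α / α) := by
          have := ht.2
          gcongr
      _ ≤ W τ * (1 / 4) := mul_le_mul_of_nonneg_left hsmall hZ0
      _ = W τ / 4 := by ring
  have hτQ : W τ ≤ Q + W τ / 4 := by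
    have hcl : closure (Ioc u T) = Icc u T := closure_Ioc huT.ne
    refine le_on_closure (g := fun _ => Q + W τ / 4) (s := Ioc u T) (fun t ht => ?_) (hcl ▸ hW)
      continuousOn_const (hcl ▸ hτ)
    linarith [hqQ t ht, (abs_le.mp (hest t ht)).2]
  have hWT : 0 < W T := by
    have := (abs_le.mp (hest T ⟨huT, le_rfl⟩)).1
    simp only [Q] at hτQ hQ
    linarith
  exact pos_of_mul_pos_right hWT (Real.rpow_nonneg huT'.le _)

end

/-- If the initial values are ordered, so are the solutions at every time in `[0,T]`. -/
theorem caputo_solutions_order_preserved (α T : ℝ) (hα : 0 < α) (hα1 : α ≤ 1) (hT : 0 < T)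
    (f : ℝ → ℝ → ℝ)
    (hf : ContinuousOn (fun p : ℝ × ℝ => f p.1 p.2) (Set.Icc 0 T ×ˢ Set.univ))
    (L : ℝ → ℝ) (hLc : ContinuousOn L (Set.Icc 0 T))
    (hLnn : ∀ t ∈ Set.Icc 0 T, 0 ≤ L t)
    (hLip : ∀ t ∈ Set.Icc 0 T, ∀ x y : ℝ, |f t x - f t y| ≤ L t * |x - y|)
    (x₁₀ x₂₀ : ℝ) (hlt : x₁₀ < x₂₀) (x₁ x₂ : ℝ → ℝ)
    (hx₁ : IsCaputoSolution α T f x₁₀ x₁) (hx₂ : IsCaputoSolution α T f x₂₀ x₂) :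
    ∀ t ∈ Set.Icc 0 T, x₁ t < x₂ t := by
  obtain ⟨hc₁, he₁⟩ := hx₁
  obtain ⟨hc₂, he₂⟩ := hx₂
  have hΓ : 0 < Real.Gamma α := Real.Gamma_pos_of_pos hα
  have hfc : ∀ x : ℝ → ℝ, ContinuousOn x (Icc 0 T) →
      ContinuousOn (fun s => f s (x s)) (Icc 0 T) := fun x hx =>
    hf.comp (continuousOn_id.prodMk hx) fun s hs => ⟨hs, mem_univ _⟩
  set d : ℝ → ℝ := fun s => 1 / Real.Gamma α * (f s (x₂ s) - f s (x₁ s))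
  have hd : ContinuousOn d (Icc 0 T) := continuousOn_const.mul ((hfc x₂ hc₂).sub (hfc x₁ hc₁))
  set g : ℝ → ℝ := IccExtend hT.le ((Icc 0 T).domRestrict d)
  have hgd : ∀ s ∈ Icc 0 T, g s = d s := fun s hs => IccExtend_of_mem hT.le _ hs
  have hg : Continuous g := (continuousOn_iff_continuous_domRestrict.mp hd).Icc_extend'
  obtain ⟨C, hC⟩ := isCompact_Icc.exists_bound_of_continuousOn hd
  have hgC : ∀ s, |g s| ≤ C := fun s => hC _ (projIcc 0 T hT.le s).2
  obtain ⟨K, hK⟩ := isCompact_Icc.exists_bound_of_continuousOn hLc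
  have hK0 : 0 ≤ K := (norm_nonneg _).trans (hK 0 ⟨le_rfl, hT.le⟩)
  set z : ℝ → ℝ := fun t => x₂ t - x₁ t
  have hz : ContinuousOn z (Icc 0 T) := hc₂.sub hc₁
  have heq : ∀ t ∈ Icc 0 T, z t = (x₂₀ - x₁₀) + truncatedIntegral α g t t := by
    intro t ht
    have hint : ∀ x : ℝ → ℝ, ContinuousOn x (Icc 0 T) →
        IntervalIntegrable (fun s => (t - s) ^ (α - 1) * f s (x s)) volume 0 t := fun x hx =>
      (intervalIntegrable_sub_rpow hα t 0 t).mul_continuousOn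
        ((hfc x hx).mono (by rw [uIcc_of_le ht.1]; exact Icc_subset_Icc_right ht.2))
    have hI : truncatedIntegral α g t t = 1 / Real.Gamma α *
        ((∫ s in (0:ℝ)..t, (t - s) ^ (α - 1) * f s (x₂ s)) -
          ∫ s in (0:ℝ)..t, (t - s) ^ (α - 1) * f s (x₁ s)) := by
      rw [← intervalIntegral.integral_sub (hint x₂ hc₂) (hint x₁ hc₁),
        ← intervalIntegral.integral_const_mul]
      refine integral_congr fun s hs => ?_
      rw [uIcc_of_le ht.1] at hs
      simp only [hgd s ⟨hs.1, hs.2.trans ht.2⟩, d]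
      ring
    simp only [z]
    rw [hI, he₂ t ht, he₁ t ht]
    ring
  have hgz : ∀ t ∈ Icc 0 T, 0 < z t → |g t| ≤ 1 / Real.Gamma α * K * z t := by
    intro t ht hzt
    rw [hgd t ht, abs_mul, abs_of_pos (one_div_pos.mpr hΓ), mul_assoc]
    refine mul_le_mul_of_nonneg_left ?_ (one_div_pos.mpr hΓ).le
    refine (hLip t ht _ _).trans ?_
    rw [show |x₂ t - x₁ t| = z t from abs_of_pos hzt]
    exact mul_le_mul_of_nonneg_right ((le_abs_self _).trans (hK t ht)) hzt.le
  by_contra! hex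
  obtain ⟨t, ht, hle⟩ := hex
  have hcomp : IsCompact (Icc 0 T ∩ z ⁻¹' Iic 0) :=
    isCompact_Icc.of_isClosed_subset (hz.preimage_isClosed_of_isClosed isClosed_Icc isClosed_Iic)
      inter_subset_left
  obtain ⟨τ, ⟨hτ, hzτ⟩, hleast⟩ := hcomp.exists_isLeast
    ⟨t, ht, by simpa only [mem_preimage, mem_Iic, z, sub_nonpos] using hle⟩
  have hτ0 : 0 < τ := by
    refine lt_of_le_of_ne hτ.1 fun h => ?_
    subst h
    have h0 := heq 0 hτ
    simp only [truncatedIntegral, integral_same] at h0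
    have : z 0 ≤ 0 := hzτ
    linarith
  have hpos : ∀ s ∈ Ico 0 τ, 0 < z s := by
    intro s hs
    by_contra! h
    exact absurd (hleast ⟨⟨hs.1, hs.2.le.trans hτ.2⟩, h⟩) (not_le.mpr hs.2)
  have hsub : Icc 0 τ ⊆ Icc 0 T := Icc_subset_Icc_right hτ.2
  have hcontra : 0 < z τ := pos_of_eq_add_truncatedIntegral hα hα1 hg hgC hτ0
    (sub_pos.mpr hlt).le (mul_nonneg (one_div_pos.mpr hΓ).le hK0) (hz.mono hsub)
    (fun s hs => heq s (hsub hs)) hpos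
    fun s hs => hgz s (hsub (Ico_subset_Icc_self hs)) (hpos s hs)
  exact absurd hzτ (not_le.mpr hcontra)
end

section
/- Let α ∈ (0,1], T > 0, and let f : [0,T] × ℝ → ℝ be continuous and satisfy the Lipschitz condition with continuous L : [0,T] → [0,∞). Let x₁ and x₂ be solutions on [0,T] of the Caputo fractional initial value problems with the same f and initial values x₁₀ ≠ x₂₀. Then for all t ∈ [0,T]: |x₁(t) − x₂(t)| ≥ |x₁₀ − x₂₀| · E_α(−L*(t) t^α), where L*(t) := max_{τ ∈ [0,t]} L(τ). -/
open Set intervalIntegral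

section

open MeasureTheory

lemma intervalIntegrable_beta {p q : ℝ} (hp : 0 < p) (hq : 0 < q) :
    IntervalIntegrable (fun y : ℝ => y ^ (p - 1) * (1 - y) ^ (q - 1)) volume 0 1 := by
  have h := Complex.betaIntegral_convergent (u := (p : ℂ)) (v := (q : ℂ)) (by simpa) (by simpa)
  rw [intervalIntegrable_iff_integrableOn_Ioc_of_le zero_le_one] at h ⊢
  refine h.re.congr ?_
  filter_upwards [ae_restrict_mem measurableSet_Ioc] with x hx
  have h1 : (0 : ℝ) ≤ 1 - x := by linarith [hx.2]
  have : (x : ℂ) ^ ((p : ℂ) - 1) * (1 - (x : ℂ)) ^ ((q : ℂ) - 1)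
      = ((x ^ (p - 1) * (1 - x) ^ (q - 1) : ℝ) : ℂ) := by
    push_cast [Complex.ofReal_cpow hx.1.le, Complex.ofReal_cpow h1]
    rfl
  rw [this]; simp

lemma integral_rpow_mul_sub_rpow {p q a : ℝ} (hp : 0 < p) (hq : 0 < q) (ha : 0 < a) :
    ∫ x in (0:ℝ)..a, x ^ (p - 1) * (a - x) ^ (q - 1) =
      a ^ (p + q - 1) * (Real.Gamma p * Real.Gamma q / Real.Gamma (p + q)) := by
  have h := Complex.betaIntegral_scaled (p : ℂ) (q : ℂ) ha
  rw [Complex.betaIntegral_eq_Gamma_mul_div _ _ (by simpa) (by simpa), ← Complex.ofReal_add,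
    Complex.Gamma_ofReal, Complex.Gamma_ofReal, Complex.Gamma_ofReal] at h
  have hc : ∫ x in (0:ℝ)..a, (x : ℂ) ^ ((p : ℂ) - 1) * ((a : ℂ) - x) ^ ((q : ℂ) - 1)
      = ((∫ x in (0:ℝ)..a, x ^ (p - 1) * (a - x) ^ (q - 1) : ℝ) : ℂ) := by
    rw [← intervalIntegral.integral_ofReal]
    refine intervalIntegral.integral_congr fun x hx => ?_
    rw [uIcc_of_le ha.le] at hx
    have h1 : (0 : ℝ) ≤ a - x := by linarith [hx.2]
    push_cast [Complex.ofReal_cpow hx.1, Complex.ofReal_cpow h1]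
    rfl
  rw [hc] at h
  have h2 : (a : ℂ) ^ ((p + q : ℝ) - 1 : ℂ) = ((a ^ (p + q - 1) : ℝ) : ℂ) := by
    rw [Complex.ofReal_cpow ha.le]; push_cast; rfl
  rw [h2] at h
  exact_mod_cast h

/-- The Möbius substitution carrying the Beta integral to the Poisson-type kernel. -/
lemma poissonKernel_integral {α σ s t : ℝ} (hα : 0 < α) (hα1 : α < 1) (hσ : σ < s) (hs : s < t) :
    IntegrableOn (fun τ => (s - τ) ^ (-α) / (t - τ) * (τ - σ) ^ (α - 1)) (Ioo σ s) ∧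
    ∫ τ in Ioo σ s, (s - τ) ^ (-α) / (t - τ) * (τ - σ) ^ (α - 1) =
      Real.Gamma α * Real.Gamma (1 - α) * ((t - s) ^ (-α) * (t - σ) ^ (α - 1)) := by
  obtain ⟨a, ha, rfl⟩ : ∃ a, 0 < a ∧ s = σ + a := ⟨s - σ, by linarith, by ring⟩
  obtain ⟨b, hb, rfl⟩ : ∃ b, 0 < b ∧ t = σ + a + b := ⟨t - (σ + a), by linarith, by ring⟩
  set ψ : ℝ → ℝ := fun y => σ + a * (a + b) * y / (b + a * y) with hψ
  have hD : ∀ y ∈ Ioo (0:ℝ) 1, 0 < b + a * y := fun y hy => by have := hy.1; positivity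
  have himg : ψ '' Ioo 0 1 = Ioo σ (σ + a) := by
    ext v
    constructor
    · rintro ⟨y, hy, rfl⟩
      have h := hD y hy
      refine ⟨?_, ?_⟩
      · have := hy.1
        simp only [hψ]
        have : 0 < a * (a + b) * y / (b + a * y) := by positivity
        linarith
      · simp only [hψ]
        have : a * (a + b) * y / (b + a * y) < a := by
          rw [div_lt_iff₀ h]
          nlinarith [mul_pos (mul_pos ha hb) (sub_pos.2 hy.2)]
        linarith
    · intro hv
      have h1 : 0 < v - σ := by linarith [hv.1]
      have h2 : 0 < σ + a - v := by linarith [hv.2]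
      have h3 : 0 < a * (a + b) - a * (v - σ) := by nlinarith
      refine ⟨b * (v - σ) / (a * (a + b) - a * (v - σ)), ⟨by positivity, ?_⟩, ?_⟩
      · rw [div_lt_one h3]; nlinarith
      · simp only [hψ]
        have h4 : a + b - (v - σ) ≠ 0 := by nlinarith
        have h5 : b + a * (b * (v - σ) / (a * (a + b) - a * (v - σ)))
          = b * (a + b) / (a + b - (v - σ)) := by
          rw [← mul_sub]; field_simp; ring
        rw [h5, ← mul_sub]; field_simp; ring
  have hder : ∀ y ∈ Ioo (0:ℝ) 1,
      HasDerivWithinAt ψ (a * (a + b) * b / (b + a * y) ^ 2) (Ioo 0 1) y := by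
    intro y hy
    have h := (hD y hy).ne'
    have h1 : HasDerivAt (fun y : ℝ => a * (a + b) * y) (a * (a + b)) y := by
      simpa using (hasDerivAt_id y).const_mul (a * (a + b))
    have h2 : HasDerivAt (fun y : ℝ => b + a * y) a y := by
      simpa using ((hasDerivAt_id y).const_mul a).const_add b
    refine (((h1.div h2 h).const_add σ).congr_deriv ?_).hasDerivWithinAt
    congr 1; ring
  have hinj : InjOn ψ (Ioo 0 1) := by
    intro y hy y' hy' h
    have h1 := (hD y hy).ne'
    have h2 := (hD y' hy').ne'
    simp only [hψ, add_right_inj] at h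
    rw [div_eq_div_iff h1 h2] at h
    have : a * (a + b) * b * (y - y') = 0 := by linarith
    have h3 : a * (a + b) * b ≠ 0 := by positivity
    linarith [(mul_eq_zero.1 this).resolve_left h3]
  have hcongr : ∀ y ∈ Ioo (0:ℝ) 1, |a * (a + b) * b / (b + a * y) ^ 2| •
      ((σ + a - ψ y) ^ (-α) / (σ + a + b - ψ y) * (ψ y - σ) ^ (α - 1)) =
      (b ^ (-α) * (a + b) ^ (α - 1)) * (y ^ (α - 1) * (1 - y) ^ ((1 - α) - 1)) := by
    intro y hy
    have h := hD y hy
    have hy0 := hy.1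
    have hy1 : 0 < 1 - y := by linarith [hy.2]
    have e1 : σ + a - ψ y = a * b * (1 - y) / (b + a * y) := by
      simp only [hψ]; field_simp; ring
    have e2 : σ + a + b - ψ y = b * (a + b) / (b + a * y) := by
      simp only [hψ]; field_simp; ring
    have e3 : ψ y - σ = a * (a + b) * y / (b + a * y) := by simp only [hψ]; ring
    rw [e1, e2, e3, abs_of_pos (by positivity), smul_eq_mul]
    rw [show (1 - α) - 1 = -α by ring]
    rw [Real.div_rpow (by positivity) h.le, Real.div_rpow (by positivity) h.le,
      Real.mul_rpow (by positivity) hy1.le, Real.mul_rpow ha.le hb.le,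
      Real.mul_rpow (by positivity) hy0.le, Real.mul_rpow ha.le (by positivity),
      Real.rpow_sub_one ha.ne', Real.rpow_sub_one h.ne',
      Real.rpow_neg ha.le, Real.rpow_neg h.le]
    have p1 := Real.rpow_pos_of_pos ha α
    have p2 := Real.rpow_pos_of_pos h α
    field_simp
  have hbeta := intervalIntegrable_beta hα (sub_pos.2 hα1)
  rw [intervalIntegrable_iff_integrableOn_Ioo_of_le zero_le_one] at hbeta
  have hval := integral_rpow_mul_sub_rpow hα (sub_pos.2 hα1) one_pos
  rw [intervalIntegral.integral_of_le zero_le_one, integral_Ioc_eq_integral_Ioo] at hval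
  rw [← himg, integrableOn_image_iff_integrableOn_abs_deriv_smul measurableSet_Ioo hder hinj,
    integral_image_eq_integral_abs_deriv_smul measurableSet_Ioo hder hinj]
  refine ⟨IntegrableOn.congr_fun
    (Integrable.const_mul hbeta (b ^ (-α) * (a + b) ^ (α - 1)))
    (fun y hy => (hcongr y hy).symm) measurableSet_Ioo, ?_⟩
  rw [setIntegral_congr_fun measurableSet_Ioo hcongr,
    MeasureTheory.integral_const_mul, hval]
  rw [show σ + a + b - (σ + a) = b by ring, show σ + a + b - σ = a + b by ring]
  simp
  ring

/-- The truncated fractional integral at a later time is a Poisson-type average of the values of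
the fractional integral at earlier times. -/
lemma integral_poissonKernel_mul {α s t : ℝ} {u : ℝ → ℝ} (hα : 0 < α) (hα1 : α < 1) (hs : 0 < s)
    (hst : s < t) (hu : ContinuousOn u (Icc 0 s)) :
    IntegrableOn (fun τ => (s - τ) ^ (-α) / (t - τ) *
      ∫ σ in (0:ℝ)..τ, (τ - σ) ^ (α - 1) * u σ) (Ioo 0 s) ∧
    ∫ τ in Ioo 0 s, (s - τ) ^ (-α) / (t - τ) * (∫ σ in (0:ℝ)..τ, (τ - σ) ^ (α - 1) * u σ) =
      Real.Gamma α * Real.Gamma (1 - α) * (t - s) ^ (-α) *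
        ∫ σ in (0:ℝ)..s, (t - σ) ^ (α - 1) * u σ := by
  set P : ℝ → ℝ := fun τ => (s - τ) ^ (-α) / (t - τ) with hP
  set K : ℝ → ℝ → ℝ := fun τ σ => (Ioi σ).indicator (fun τ => P τ * (τ - σ) ^ (α - 1)) τ with hK
  have hKmeas : Measurable (Function.uncurry K) := by
    have : Function.uncurry K = {p : ℝ × ℝ | p.2 < p.1}.indicator
        (fun p => P p.1 * (p.1 - p.2) ^ (α - 1)) := by
      ext ⟨x, y⟩
      simp [K, indicator, Function.uncurry]
    rw [this]
    refine Measurable.indicator ?_ (measurableSet_lt measurable_snd measurable_fst)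
    simp only [hP]
    fun_prop
  have hPnn : ∀ τ ∈ Ioo 0 s, 0 ≤ P τ := fun τ hτ =>
    div_nonneg (Real.rpow_nonneg (by linarith [hτ.2]) _) (by linarith [hτ.2])
  have hinter : ∀ σ ∈ Ioo 0 s, Ioo 0 s ∩ Ioi σ = Ioo σ s := by
    intro σ hσ
    ext x; simp only [mem_inter_iff, mem_Ioo, mem_Ioi]
    constructor
    · rintro ⟨h1, h2⟩; exact ⟨h2, h1.2⟩
    · rintro ⟨h1, h2⟩; exact ⟨⟨hσ.1.trans h1, h2⟩, h1⟩
  have hKint : ∀ σ ∈ Ioo 0 s, IntegrableOn (fun τ => K τ σ) (Ioo 0 s) ∧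
      ∫ τ in Ioo 0 s, K τ σ =
        Real.Gamma α * Real.Gamma (1 - α) * ((t - s) ^ (-α) * (t - σ) ^ (α - 1)) := by
    intro σ hσ
    obtain ⟨h1, h2⟩ := poissonKernel_integral hα hα1 hσ.2 hst
    constructor
    · simp only [hK]
      rw [IntegrableOn, integrable_indicator_iff measurableSet_Ioi, IntegrableOn,
        Measure.restrict_restrict measurableSet_Ioi, inter_comm, hinter σ hσ]
      exact h1
    · simp only [hK]
      rw [setIntegral_indicator measurableSet_Ioi, hinter σ hσ]
      exact h2
  have hKnn : ∀ σ, ∀ τ ∈ Ioo 0 s, 0 ≤ K τ σ := by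
    intro σ τ hτ
    refine indicator_apply_nonneg fun h => mul_nonneg (hPnn τ hτ) (Real.rpow_nonneg ?_ _)
    exact (sub_pos.2 h).le
  have hint : Integrable (Function.uncurry fun τ σ => K τ σ * u σ)
      ((volume.restrict (Ioo 0 s)).prod (volume.restrict (Ioo 0 s))) := by
    have hum : AEStronglyMeasurable u (volume.restrict (Ioo 0 s)) :=
      (hu.mono Ioo_subset_Icc_self).aestronglyMeasurable measurableSet_Ioo
    have hKu : AEStronglyMeasurable (Function.uncurry fun τ σ => K τ σ * u σ)
        ((volume.restrict (Ioo 0 s)).prod (volume.restrict (Ioo 0 s))) :=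
      hKmeas.aestronglyMeasurable.mul hum.comp_snd
    rw [integrable_prod_iff' hKu]
    constructor
    · filter_upwards [ae_restrict_mem measurableSet_Ioo] with σ hσ
      exact Integrable.mul_const (hKint σ hσ).1 (u σ)
    · have hcont : IntegrableOn (fun σ => Real.Gamma α * Real.Gamma (1 - α) *
          ((t - s) ^ (-α) * (t - σ) ^ (α - 1)) * |u σ|) (Ioo 0 s) := by
        refine (ContinuousOn.integrableOn_Icc ?_).mono_set Ioo_subset_Icc_self
        refine ContinuousOn.mul (continuousOn_const.mul (continuousOn_const.mul ?_)) hu.abs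
        refine ContinuousOn.rpow_const (by fun_prop) fun x hx => Or.inl ?_
        linarith [hx.2]
      refine Integrable.congr hcont ?_
      filter_upwards [ae_restrict_mem measurableSet_Ioo] with σ hσ
      rw [← (hKint σ hσ).2, ← MeasureTheory.integral_mul_const]
      refine setIntegral_congr_fun measurableSet_Ioo fun τ hτ => ?_
      simp [Function.uncurry, abs_of_nonneg (hKnn σ τ hτ)]
  have hinner : ∀ τ ∈ Ioo 0 s, ∫ σ in Ioo 0 s, K τ σ * u σ =
      P τ * ∫ σ in (0:ℝ)..τ, (τ - σ) ^ (α - 1) * u σ := by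
    intro τ hτ
    have : ∀ σ, K τ σ * u σ = (Iio τ).indicator (fun σ => P τ * ((τ - σ) ^ (α - 1) * u σ)) σ := by
      intro σ
      by_cases h : σ < τ <;> simp [K, indicator, h, mul_assoc]
    simp_rw [this]
    rw [setIntegral_indicator measurableSet_Iio, MeasureTheory.integral_const_mul,
      intervalIntegral.integral_of_le hτ.1.le, integral_Ioc_eq_integral_Ioo]
    congr 3
    ext x; simp only [mem_inter_iff, mem_Ioo, mem_Iio]
    constructor
    · rintro ⟨h1, h2⟩; exact ⟨h1.1, h2⟩
    · rintro ⟨h1, h2⟩; exact ⟨⟨h1, h2.trans hτ.2⟩, h2⟩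
  constructor
  · refine Integrable.congr hint.integral_prod_left ?_
    filter_upwards [ae_restrict_mem measurableSet_Ioo] with τ hτ
    exact hinner τ hτ
  · rw [← setIntegral_congr_fun measurableSet_Ioo hinner, integral_integral_swap hint,
      intervalIntegral.integral_of_le hs.le, integral_Ioc_eq_integral_Ioo,
      ← MeasureTheory.integral_const_mul]
    refine setIntegral_congr_fun measurableSet_Ioo fun σ hσ => ?_
    rw [MeasureTheory.integral_mul_const, (hKint σ hσ).2]
    ring

lemma neg_lt_truncated_fractional_integral {α s t m : ℝ} {u : ℝ → ℝ} (hα : 0 < α) (hα1 : α ≤ 1)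
    (hs : 0 ≤ s) (hst : s < t) (hu : ContinuousOn u (Icc 0 s)) (hm : 0 < m)
    (hle : ∀ τ ∈ Icc 0 s, -m ≤ ∫ σ in (0:ℝ)..τ, (τ - σ) ^ (α - 1) * u σ)
    (hlt : -m < ∫ σ in (0:ℝ)..s, (s - σ) ^ (α - 1) * u σ) :
    -m < ∫ σ in (0:ℝ)..s, (t - σ) ^ (α - 1) * u σ := by
  rcases hα1.eq_or_lt with rfl | hα1
  · simpa using hlt
  rcases hs.eq_or_lt with rfl | hs
  · simpa using hm
  obtain ⟨hi, heq⟩ := integral_poissonKernel_mul hα hα1 hs hst hu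
  obtain ⟨hi1, heq1⟩ := poissonKernel_integral hα hα1 hs hst
  set C := Real.Gamma α * Real.Gamma (1 - α) with hC
  have hCpos : 0 < C := mul_pos (Real.Gamma_pos_of_pos hα) (Real.Gamma_pos_of_pos (by linarith))
  have hd : 0 < (t - s) ^ (-α) := Real.rpow_pos_of_pos (by linarith) _
  have hsp : 0 < s ^ (α - 1) := Real.rpow_pos_of_pos hs _
  have hts : t ^ (α - 1) < s ^ (α - 1) := Real.rpow_lt_rpow_of_neg hs hst (by linarith)
  have hmono : ∫ τ in Ioo 0 s, -(m / s ^ (α - 1)) * ((s - τ) ^ (-α) / (t - τ) * (τ - 0) ^ (α - 1))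
      ≤ ∫ τ in Ioo 0 s, (s - τ) ^ (-α) / (t - τ) * ∫ σ in (0:ℝ)..τ, (τ - σ) ^ (α - 1) * u σ := by
    refine setIntegral_mono_on (hi1.const_mul _) hi measurableSet_Ioo fun τ hτ => ?_
    have hP : 0 ≤ (s - τ) ^ (-α) / (t - τ) :=
      div_nonneg (Real.rpow_nonneg (by linarith [hτ.2]) _) (by linarith [hτ.2])
    have h1 : s ^ (α - 1) ≤ (τ - 0) ^ (α - 1) := by
      rw [sub_zero]
      exact Real.rpow_le_rpow_of_nonpos hτ.1 hτ.2.le (by linarith)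
    have h2 : m ≤ m / s ^ (α - 1) * (τ - 0) ^ (α - 1) := by
      rw [div_mul_eq_mul_div, le_div_iff₀ hsp]
      gcongr
    calc _ = (s - τ) ^ (-α) / (t - τ) * -(m / s ^ (α - 1) * (τ - 0) ^ (α - 1)) := by ring
      _ ≤ (s - τ) ^ (-α) / (t - τ) * -m := by gcongr
      _ ≤ _ := mul_le_mul_of_nonneg_left (hle τ ⟨hτ.1.le, hτ.2.le⟩) hP
  rw [MeasureTheory.integral_const_mul, heq1, heq, sub_zero] at hmono
  have h3 : -m < -(m / s ^ (α - 1)) * t ^ (α - 1) := by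
    rw [neg_mul, neg_lt_neg_iff, div_mul_eq_mul_div, div_lt_iff₀ hsp]
    gcongr
  refine h3.trans_le ?_
  refine le_of_mul_le_mul_left (a := C * (t - s) ^ (-α)) ?_ (by positivity)
  calc _ = _ := by ring
    _ ≤ _ := hmono

lemma intervalIntegrable_fractional_kernel {α a b t : ℝ} {u : ℝ → ℝ} (hα : 0 < α)
    (hu : ContinuousOn u (uIcc a b)) :
    IntervalIntegrable (fun σ => (t - σ) ^ (α - 1) * u σ) volume a b := by
  refine IntervalIntegrable.mul_continuousOn ?_ hu
  have h := (intervalIntegrable_rpow' (a := t - a) (b := t - b) (r := α - 1)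
    (by linarith)).comp_sub_left t
  simpa using h

/-- Maximum principle: a fractional integral whose integrand is nonnegative wherever the
fractional integral is below a level `c ≤ 0` stays above that level. -/
lemma fractional_integral_ge {α T c : ℝ} {u w : ℝ → ℝ} (hα : 0 < α) (hα1 : α ≤ 1) (hT : 0 ≤ T)
    (hc : c ≤ 0) (hu : ContinuousOn u (Icc 0 T)) (hw : ContinuousOn w (Icc 0 T))
    (hwu : ∀ t ∈ Icc 0 T, w t = ∫ σ in (0:ℝ)..t, (t - σ) ^ (α - 1) * u σ)
    (hpos : ∀ t ∈ Icc 0 T, w t < c → 0 ≤ u t) :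
    ∀ t ∈ Icc 0 T, c ≤ w t := by
  obtain ⟨t, ht, hmin⟩ := isCompact_Icc.exists_isMinOn (nonempty_Icc.2 hT) hw
  have hmin' : ∀ r ∈ Icc 0 T, w t ≤ w r := fun r hr => hmin hr
  by_contra! hcon
  obtain ⟨r, hr, hrc⟩ := hcon
  have htc : w t < c := (hmin' r hr).trans_lt hrc
  set S : Set ℝ := Icc 0 t ∩ w ⁻¹' Ici c with hS
  have hSub : Icc 0 t ⊆ Icc 0 T := Icc_subset_Icc_right ht.2
  have hScl : IsClosed S := (hw.mono hSub).preimage_isClosed_of_isClosed isClosed_Icc isClosed_Ici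
  have hScpt : IsCompact S := isCompact_Icc.of_isClosed_subset hScl inter_subset_left
  have h0 : (0:ℝ) ∈ S := by
    refine ⟨⟨le_rfl, ht.1⟩, ?_⟩
    simp [hwu 0 ⟨le_rfl, hT⟩, hc]
  obtain ⟨s, hsS, hsmax⟩ := hScpt.exists_isGreatest ⟨0, h0⟩
  have hsc : c ≤ w s := hsS.2
  have hst : s < t := lt_of_le_of_ne hsS.1.2 (by rintro rfl; linarith)
  have hsT : Icc 0 s ⊆ Icc 0 T := (Icc_subset_Icc_right hst.le).trans hSub
  have hupos : ∀ r ∈ Ioc s t, 0 ≤ u r := by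
    intro r hr
    have hrt : r ∈ Icc 0 t := ⟨hsS.1.1.trans hr.1.le, hr.2⟩
    refine hpos r (hSub hrt) ?_
    by_contra! h
    exact absurd (hsmax ⟨hrt, h⟩) (not_le.2 hr.1)
  have key := neg_lt_truncated_fractional_integral (m := -w t) hα hα1 hsS.1.1 hst (hu.mono hsT)
    (by linarith) (fun τ hτ => by rw [neg_neg, ← hwu τ (hsT hτ)]; exact hmin' τ (hsT hτ))
    (by rw [neg_neg, ← hwu s (hSub hsS.1)]; linarith)
  have hsplit := integral_add_adjacent_intervals
    (intervalIntegrable_fractional_kernel (t := t) hα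
      ((hu.mono hsT).mono (uIcc_of_le hsS.1.1).subset))
    (intervalIntegrable_fractional_kernel (a := s) (b := t) (t := t) hα
      (hu.mono (by rw [uIcc_of_le hst.le]; exact Icc_subset_Icc hsS.1.1 ht.2)))
  have hnn : 0 ≤ ∫ σ in s..t, (t - σ) ^ (α - 1) * u σ := by
    rw [intervalIntegral.integral_of_le hst.le]
    exact setIntegral_nonneg measurableSet_Ioc fun σ hσ =>
      mul_nonneg (Real.rpow_nonneg (by linarith [hσ.2]) _) (hupos σ hσ)
  have := hwu t ht
  linarith

lemma rpow_mul_exp_neg_le_Gamma {y R : ℝ} (hy : 0 ≤ y) (hR : 0 < R) :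
    R ^ y * Real.exp (-R) ≤ Real.Gamma (y + 1) := by
  have hconv := Real.GammaIntegral_convergent (s := y + 1) (by linarith)
  rw [Real.Gamma_eq_integral (by linarith), ← integral_exp_neg_Ioi R,
    ← MeasureTheory.integral_const_mul]
  have hsub : Ioi R ⊆ Ioi (0:ℝ) := Ioi_subset_Ioi hR.le
  calc ∫ x in Ioi R, R ^ y * Real.exp (-x)
      ≤ ∫ x in Ioi R, Real.exp (-x) * x ^ (y + 1 - 1) := by
        refine setIntegral_mono_on ((integrableOn_exp_neg_Ioi R).const_mul _) (hconv.mono_set hsub)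
          measurableSet_Ioi fun x hx => ?_
        rw [add_sub_cancel_right, mul_comm]
        gcongr
        exact (mem_Ioi.1 hx).le
    _ ≤ _ := by
        refine setIntegral_mono_set hconv ?_ (Filter.Eventually.of_forall hsub)
        filter_upwards [ae_restrict_mem measurableSet_Ioi] with x hx
        exact mul_nonneg (Real.exp_pos _).le (Real.rpow_nonneg (mem_Ioi.1 hx).le _)

lemma summable_mittagLeffler {α : ℝ} (hα : 0 < α) (x : ℝ) :
    Summable fun k : ℕ => x ^ k / Real.Gamma (α * (k : ℝ) + 1) := by
  set R : ℝ := (2 * |x| + 1) ^ (1 / α) with hR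
  have hR0 : 0 < R := Real.rpow_pos_of_pos (by positivity) _
  have hRα : R ^ α = 2 * |x| + 1 := by
    rw [hR, ← Real.rpow_mul (by positivity), one_div_mul_cancel hα.ne', Real.rpow_one]
  have hgeo : Summable fun k : ℕ => Real.exp R * (|x| / (2 * |x| + 1)) ^ k := by
    refine (summable_geometric_of_lt_one (by positivity) ?_).mul_left _
    rw [div_lt_one (by positivity)]
    linarith [abs_nonneg x]
  refine hgeo.of_norm_bounded fun k => ?_
  have hk : 0 ≤ α * (k : ℝ) := by positivity
  have hG := rpow_mul_exp_neg_le_Gamma hk hR0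
  rw [Real.rpow_mul hR0.le, hRα, Real.rpow_natCast, Real.exp_neg] at hG
  rw [norm_div, norm_pow, Real.norm_eq_abs, Real.norm_eq_abs,
    abs_of_pos (Real.Gamma_pos_of_pos (by linarith))]
  calc |x| ^ k / Real.Gamma (α * k + 1)
      ≤ |x| ^ k / ((2 * |x| + 1) ^ k * (Real.exp R)⁻¹) := by gcongr
    _ = _ := by rw [div_pow]; field_simp

lemma continuous_mittagLeffler {α : ℝ} (hα : 0 < α) : Continuous (mittagLeffler α) := by
  rw [continuous_iff_continuousAt]
  intro x
  have hon : ContinuousOn (mittagLeffler α) (Icc (x - 1) (x + 1)) := by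
    refine continuousOn_tsum (fun k => by fun_prop) (summable_mittagLeffler hα (|x| + 1))
      fun k y hy => ?_
    have hG : 0 < Real.Gamma (α * (k : ℝ) + 1) := Real.Gamma_pos_of_pos (by positivity)
    rw [norm_div, norm_pow, Real.norm_eq_abs, Real.norm_eq_abs, abs_of_pos hG]
    have : |y| ≤ |x| + 1 := by
      have h := abs_add_le x (y - x)
      rw [add_sub_cancel] at h
      have : |y - x| ≤ 1 := abs_le.2 ⟨by linarith [hy.1], by linarith [hy.2]⟩
      linarith
    gcongr
  exact hon.continuousAt (Icc_mem_nhds (by linarith) (by linarith))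

lemma mittagLeffler_zero (α : ℝ) : mittagLeffler α 0 = 1 := by
  rw [mittagLeffler, tsum_eq_single 0 fun k hk => by simp [hk]]
  simp

lemma continuous_mittagLeffler_rpow {α : ℝ} (hα : 0 < α) (c : ℝ) :
    Continuous fun t : ℝ => mittagLeffler α (c * t ^ α) :=
  (continuous_mittagLeffler hα).comp
    (continuous_const.mul (Real.continuous_rpow_const hα.le))

/-- `t ↦ E_α(c t^α)` solves the linear Caputo equation with coefficient `c`. -/
lemma mittagLeffler_rpow_eq {α c t : ℝ} (hα : 0 < α) (ht : 0 ≤ t) :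
    Real.Gamma α * (mittagLeffler α (c * t ^ α) - 1) =
      ∫ s in (0:ℝ)..t, (t - s) ^ (α - 1) * (c * mittagLeffler α (c * s ^ α)) := by
  rcases ht.eq_or_lt with rfl | ht
  · simp [Real.zero_rpow hα.ne', mittagLeffler_zero]
  have hGα := Real.Gamma_pos_of_pos hα
  have hG : ∀ k : ℕ, 0 < Real.Gamma (α * (k : ℝ) + 1) :=
    fun k => Real.Gamma_pos_of_pos (by positivity)
  have hint : IntervalIntegrable (fun s => (t - s) ^ (α - 1) *
      (|c| * mittagLeffler α (|c| * t ^ α))) volume 0 t :=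
    intervalIntegrable_fractional_kernel hα continuousOn_const
  have hsum := intervalIntegral.hasSum_integral_of_dominated_convergence (a := 0) (b := t)
    (μ := volume)
    (F := fun (k : ℕ) s => (t - s) ^ (α - 1) *
      (c * ((c * s ^ α) ^ k / Real.Gamma (α * (k : ℝ) + 1))))
    (f := fun s => (t - s) ^ (α - 1) * (c * mittagLeffler α (c * s ^ α)))
    (fun (k : ℕ) s => (t - s) ^ (α - 1) *
      (|c| * ((|c| * t ^ α) ^ k / Real.Gamma (α * (k : ℝ) + 1))))
    (fun k => by fun_prop)
    (fun k => Filter.Eventually.of_forall fun s hs => by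
      rw [uIoc_of_le ht.le] at hs
      have h1 : 0 ≤ t - s := by linarith [hs.2]
      have h2 : s ^ α ≤ t ^ α := Real.rpow_le_rpow hs.1.le hs.2 hα.le
      have h3 : 0 ≤ s ^ α := Real.rpow_nonneg hs.1.le _
      rw [Real.norm_eq_abs, abs_mul, abs_mul, abs_div, abs_pow, abs_mul, abs_of_pos (hG k),
        abs_of_nonneg (Real.rpow_nonneg h1 _), abs_of_nonneg h3]
      have := hG k
      gcongr)
    (Filter.Eventually.of_forall fun s _ =>
      ((summable_mittagLeffler hα _).mul_left _).mul_left _)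
    (by
      refine hint.congr ?_
      intro s _
      simp only [mittagLeffler, tsum_mul_left])
    (Filter.Eventually.of_forall fun s _ =>
      ((summable_mittagLeffler hα _).hasSum.mul_left _).mul_left _)
  rw [← hsum.tsum_eq]
  have hterm : ∀ k : ℕ, ∫ s in (0:ℝ)..t, (t - s) ^ (α - 1) *
      (c * ((c * s ^ α) ^ k / Real.Gamma (α * (k : ℝ) + 1))) =
      Real.Gamma α * ((c * t ^ α) ^ (k + 1) / Real.Gamma (α * ((k + 1 : ℕ) : ℝ) + 1)) := by
    intro k
    have hb := integral_rpow_mul_sub_rpow (p := α * k + 1) (q := α) (by positivity) hα ht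
    have : ∀ s ∈ uIcc 0 t, (t - s) ^ (α - 1) *
        (c * ((c * s ^ α) ^ k / Real.Gamma (α * (k : ℝ) + 1))) =
        (c ^ (k + 1) / Real.Gamma (α * (k : ℝ) + 1)) *
          (s ^ (α * k + 1 - 1) * (t - s) ^ (α - 1)) := by
      intro s hs
      rw [uIcc_of_le ht.le] at hs
      rw [add_sub_cancel_right, Real.rpow_mul hs.1, Real.rpow_natCast]
      ring
    rw [intervalIntegral.integral_congr this, intervalIntegral.integral_const_mul, hb]
    have e1 : α * (k : ℝ) + 1 + α - 1 = α * ((k + 1 : ℕ) : ℝ) := by push_cast; ring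
    have e2 : α * (k : ℝ) + 1 + α = α * ((k + 1 : ℕ) : ℝ) + 1 := by push_cast; ring
    rw [e1, e2, Real.rpow_mul ht.le, Real.rpow_natCast, mul_pow]
    have := (hG k).ne'
    field_simp
  simp_rw [hterm]
  rw [tsum_mul_left, mittagLeffler, (summable_mittagLeffler hα _).tsum_eq_zero_add]
  simp

lemma mittagLeffler_comparison {α T c z₀ : ℝ} {z g : ℝ → ℝ} (hα : 0 < α) (hα1 : α ≤ 1)
    (hT : 0 ≤ T) (hc : 0 ≤ c) (hz : ContinuousOn z (Icc 0 T)) (hg : ContinuousOn g (Icc 0 T))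
    (hzg : ∀ t ∈ Icc 0 T,
      Real.Gamma α * (z t - z₀) = ∫ s in (0:ℝ)..t, (t - s) ^ (α - 1) * g s)
    (hle : ∀ t ∈ Icc 0 T, -c * z t ≤ g t) :
    ∀ t ∈ Icc 0 T, z₀ * mittagLeffler α (-c * t ^ α) ≤ z t := by
  have hGα := Real.Gamma_pos_of_pos hα
  have hv := (continuous_mittagLeffler_rpow hα (-c)).continuousOn (s := Icc 0 T)
  have hV : ContinuousOn (fun s => -z₀ * (-c * mittagLeffler α (-c * s ^ α))) (Icc 0 T) :=
    continuousOn_const.mul (continuousOn_const.mul hv)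
  have key := fractional_integral_ge (c := 0)
    (u := fun s => g s + -z₀ * (-c * mittagLeffler α (-c * s ^ α)))
    (w := fun t => Real.Gamma α * (z t - z₀ * mittagLeffler α (-c * t ^ α)))
    hα hα1 hT le_rfl (hg.add hV) (continuousOn_const.mul (hz.sub (continuousOn_const.mul hv)))
    (fun t ht => by
      have hsub : uIcc 0 t ⊆ Icc 0 T := by
        rw [uIcc_of_le ht.1]; exact Icc_subset_Icc_right ht.2
      have h1 := intervalIntegrable_fractional_kernel (t := t) hα (hg.mono hsub)
      have h2 := intervalIntegrable_fractional_kernel (t := t) hα (hV.mono hsub)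
      simp_rw [mul_add]
      rw [intervalIntegral.integral_add h1 h2, ← hzg t ht]
      simp_rw [mul_left_comm _ (-z₀)]
      rw [intervalIntegral.integral_const_mul, ← mittagLeffler_rpow_eq hα ht.1]
      ring)
    (fun t ht hlt => by
      have h1 := neg_of_mul_neg_right hlt hGα.le
      have h2 := hle t ht
      nlinarith)
  intro t ht
  have := nonneg_of_mul_nonneg_right (key t ht) hGα
  linarith

lemma mittagLeffler_neg_nonneg {α x : ℝ} (hα : 0 < α) (hα1 : α ≤ 1) (hx : 0 ≤ x) :
    0 ≤ mittagLeffler α (-x) := by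
  have hGα := Real.Gamma_pos_of_pos hα
  have hv := (continuous_mittagLeffler_rpow hα (-x)).continuousOn (s := Icc 0 1)
  have key := fractional_integral_ge (c := -Real.Gamma α)
    (u := fun s => -x * mittagLeffler α (-x * s ^ α))
    (w := fun t => Real.Gamma α * (mittagLeffler α (-x * t ^ α) - 1))
    hα hα1 zero_le_one (by linarith) (continuousOn_const.mul hv)
    (continuousOn_const.mul (hv.sub continuousOn_const))
    (fun t ht => mittagLeffler_rpow_eq hα ht.1)
    (fun t ht hlt => by
      have h1 : mittagLeffler α (-x * t ^ α) < 0 := by nlinarith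
      nlinarith)
    1 ⟨zero_le_one, le_rfl⟩
  simp only [Real.one_rpow, mul_one] at key
  nlinarith

lemma mittagLeffler_neg_antitone {α x y : ℝ} (hα : 0 < α) (hα1 : α ≤ 1) (hx : 0 ≤ x)
    (hxy : x ≤ y) : mittagLeffler α (-y) ≤ mittagLeffler α (-x) := by
  have hv := (continuous_mittagLeffler_rpow hα (-x)).continuousOn (s := Icc 0 1)
  have key := mittagLeffler_comparison (z₀ := 1) (c := y)
    (z := fun t => mittagLeffler α (-x * t ^ α))
    (g := fun s => -x * mittagLeffler α (-x * s ^ α))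
    hα hα1 zero_le_one (hx.trans hxy) hv (continuousOn_const.mul hv)
    (fun t ht => mittagLeffler_rpow_eq hα ht.1)
    (fun t ht => by
      have h := mittagLeffler_neg_nonneg (x := x * t ^ α) hα hα1
        (mul_nonneg hx (Real.rpow_nonneg ht.1 _))
      rw [← neg_mul] at h
      nlinarith)
    1 ⟨zero_le_one, le_rfl⟩
  simpa using key

lemma mittagLeffler_lower_bound {α T c z₀ : ℝ} {z g : ℝ → ℝ} (hα : 0 < α) (hα1 : α ≤ 1)
    (hT : 0 ≤ T) (hc : 0 ≤ c) (hz₀ : 0 < z₀)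
    (hz : ContinuousOn z (Icc 0 T)) (hg : ContinuousOn g (Icc 0 T))
    (hzg : ∀ t ∈ Icc 0 T,
      Real.Gamma α * (z t - z₀) = ∫ s in (0:ℝ)..t, (t - s) ^ (α - 1) * g s)
    (hle : ∀ t ∈ Icc 0 T, |g t| ≤ c * |z t|) :
    z₀ * mittagLeffler α (-c * T ^ α) ≤ |z T| := by
  have hge : ∀ t ∈ Icc 0 T, 0 ≤ z t → -c * z t ≤ g t := by
    intro t ht h
    have := hle t ht
    rw [abs_of_nonneg h] at this
    linarith [(abs_le.1 this).1]
  by_cases hpos : ∀ t ∈ Icc 0 T, 0 ≤ z t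
  · exact (mittagLeffler_comparison hα hα1 hT hc hz hg hzg (fun t ht => hge t ht (hpos t ht)) T
      ⟨hT, le_rfl⟩).trans (le_abs_self _)
  push Not at hpos
  obtain ⟨r, hr, hrneg⟩ := hpos
  have hScl : IsClosed (Icc 0 T ∩ z ⁻¹' Iic 0) :=
    hz.preimage_isClosed_of_isClosed isClosed_Icc isClosed_Iic
  obtain ⟨s, hs, hsmin⟩ := (isCompact_Icc.of_isClosed_subset hScl inter_subset_left).exists_isLeast
    ⟨r, hr, hrneg.le⟩
  have hz0 : z 0 = z₀ := by
    have h := hzg 0 ⟨le_rfl, hT⟩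
    rw [intervalIntegral.integral_same, mul_eq_zero] at h
    linarith [h.resolve_left (Real.Gamma_pos_of_pos hα).ne']
  have hsub : Icc 0 s ⊆ Icc 0 T := Icc_subset_Icc_right hs.1.2
  have hzs : z s = 0 := by
    obtain ⟨y, hy, hy0⟩ := intermediate_value_Icc' hs.1.1 (hz.mono hsub)
      (show (0:ℝ) ∈ Icc (z s) (z 0) from ⟨hs.2, by rw [hz0]; exact hz₀.le⟩)
    rw [← hy0, le_antisymm hy.2 (hsmin ⟨hsub hy, hy0.le⟩)]
  have hnn : ∀ t ∈ Icc 0 s, 0 ≤ z t := by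
    intro t ht
    by_contra! h
    rw [le_antisymm ht.2 (hsmin ⟨hsub ht, h.le⟩)] at h
    exact h.ne hzs
  have h1 := mittagLeffler_comparison hα hα1 hs.1.1 hc (hz.mono hsub) (hg.mono hsub)
    (fun t ht => hzg t (hsub ht)) (fun t ht => hge t (hsub ht) (hnn t ht)) s ⟨hs.1.1, le_rfl⟩
  have h2 : mittagLeffler α (-c * T ^ α) ≤ mittagLeffler α (-c * s ^ α) := by
    rw [neg_mul, neg_mul]
    refine mittagLeffler_neg_antitone hα hα1 (mul_nonneg hc (Real.rpow_nonneg hs.1.1 _)) ?_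
    exact mul_le_mul_of_nonneg_left (Real.rpow_le_rpow hs.1.1 hs.1.2 hα.le) hc
  calc _ ≤ z₀ * mittagLeffler α (-c * s ^ α) := by gcongr
    _ ≤ z s := h1
    _ ≤ |z T| := by rw [hzs]; exact abs_nonneg _

end

/-- Lower bound for the separation of two solutions:
`|x₁(t) − x₂(t)| ≥ |x₁₀ − x₂₀| · E_α(−L*(t)·t^α)` where `L*(t) = max_{τ∈[0,t]} L(τ)`. -/
theorem caputo_separation_lower_bound (α T : ℝ) (hα : 0 < α) (hα1 : α ≤ 1) (hT : 0 < T)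
    (f : ℝ → ℝ → ℝ)
    (hf : ContinuousOn (fun p : ℝ × ℝ => f p.1 p.2) (Set.Icc 0 T ×ˢ Set.univ))
    (L : ℝ → ℝ) (hLc : ContinuousOn L (Set.Icc 0 T))
    (hLnn : ∀ t ∈ Set.Icc 0 T, 0 ≤ L t)
    (hLip : ∀ t ∈ Set.Icc 0 T, ∀ x y : ℝ, |f t x - f t y| ≤ L t * |x - y|)
    (x₁₀ x₂₀ : ℝ) (hne : x₁₀ ≠ x₂₀) (x₁ x₂ : ℝ → ℝ)
    (hx₁ : IsCaputoSolution α T f x₁₀ x₁) (hx₂ : IsCaputoSolution α T f x₂₀ x₂) :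
    ∀ t ∈ Set.Icc 0 T,
      |x₁₀ - x₂₀| * mittagLeffler α (-(sSup (L '' Set.Icc 0 t)) * t ^ α)
        ≤ |x₁ t - x₂ t| := by
  intro t ht
  wlog hlt : x₂₀ < x₁₀ generalizing x₁₀ x₂₀ x₁ x₂
  · rw [abs_sub_comm x₁₀, abs_sub_comm (x₁ t)]
    exact this x₂₀ x₁₀ hne.symm x₂ x₁ hx₂ hx₁ (lt_of_le_of_ne (not_lt.1 hlt) hne)
  have hGα := Real.Gamma_pos_of_pos hα
  have hsub : Icc 0 t ⊆ Icc 0 T := Icc_subset_Icc_right ht.2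
  have hbdd : BddAbove (L '' Icc 0 t) :=
    (isCompact_Icc.image_of_continuousOn (hLc.mono hsub)).bddAbove
  have hLle : ∀ s ∈ Icc 0 t, L s ≤ sSup (L '' Icc 0 t) :=
    fun s hs => le_csSup hbdd (mem_image_of_mem L hs)
  have hfx : ∀ x : ℝ → ℝ, ContinuousOn x (Icc 0 T) →
      ContinuousOn (fun s => f s (x s)) (Icc 0 t) :=
    fun x hx => (hf.comp (continuousOn_id.prodMk hx) fun s hs => ⟨hs, mem_univ _⟩).mono hsub
  rw [abs_of_pos (sub_pos.2 hlt)]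
  refine mittagLeffler_lower_bound (z := fun s => x₁ s - x₂ s)
    (g := fun s => f s (x₁ s) - f s (x₂ s)) hα hα1 ht.1
    ((hLnn 0 ⟨le_rfl, hT.le⟩).trans (hLle 0 ⟨le_rfl, ht.1⟩)) (sub_pos.2 hlt)
    ((hx₁.1.sub hx₂.1).mono hsub) ((hfx x₁ hx₁.1).sub (hfx x₂ hx₂.1)) (fun r hr => ?_)
    (fun s hs => (hLip s (hsub hs) _ _).trans (by gcongr; exact hLle s hs))
  have hsubr : uIcc 0 r ⊆ Icc 0 t := by
    rw [uIcc_of_le hr.1]; exact Icc_subset_Icc_right hr.2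
  simp_rw [mul_sub]
  rw [intervalIntegral.integral_sub
    (intervalIntegrable_fractional_kernel hα ((hfx x₁ hx₁.1).mono hsubr))
    (intervalIntegrable_fractional_kernel hα ((hfx x₂ hx₂.1).mono hsubr)),
    hx₁.2 r (hsub hr), hx₂.2 r (hsub hr)]
  field_simp
  ring
end
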